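/- arXiv:2210.07963 — 3 statements merged into one kernel-verified Lean document; each statement's English description precedes it below -/
import Mathlib

section
/- Bi-static joint decoding-and-detection inner bound: Under the standing assumption, for every probability distribution P_X on 𝒳 and every R > 0, every pair (R,E) ∈ ℝ₊² with R ≤ min_{s∈𝒮} I(P_X, W_{Y|X,s}) and E ≤ min( ρ_joint(P_X,R), φ(P_X) ) belongs to the closure C^(b) of the set of achievable rate/detection-error-exponent pairs of the bi-static joint communication and sensing model. -/
open scoped BigOperators ENNReal NNReal

namespace JCAS

variable {𝒳 𝒴 𝒵 𝒮 : Type}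

/-- `p` is a probability mass function on the finite alphabet `𝒳`. -/
def IsPMF [Fintype 𝒳] (p : 𝒳 → ℝ) : Prop :=
  (∀ x, 0 ≤ p x) ∧ ∑ x, p x = 1

/-- `V` is a channel (conditional probability distribution) from `𝒳` to `𝒴`. -/
def IsChannel [Fintype 𝒳] [Fintype 𝒴] (V : 𝒳 → 𝒴 → ℝ) : Prop :=
  ∀ x, IsPMF (V x)

/-- Mutual information `I(P, V)` (natural logarithm), with `0·log(0/a) = 0`. -/
noncomputable def mutualInfo [Fintype 𝒳] [Fintype 𝒴] (P : 𝒳 → ℝ) (V : 𝒳 → 𝒴 → ℝ) : ℝ :=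
  ∑ x, ∑ y, P x * V x y * Real.log (V x y / ∑ x', P x' * V x' y)

/-- `a ^ ℓ` with the convention `0 ^ ℓ = 0` (in particular `0 ^ 0 = 0`). -/
noncomputable def pow0 (a ℓ : ℝ) : ℝ := if a = 0 then 0 else a ^ ℓ

/-- `Σ_z W(z)^ℓ · W'(z)^{1-ℓ}`. -/
noncomputable def chernoffSum [Fintype 𝒵] (W W' : 𝒵 → ℝ) (ℓ : ℝ) : ℝ :=
  ∑ z, pow0 (W z) ℓ * pow0 (W' z) (1 - ℓ)

/-- Chernoff information between the channels `W` and `W'` under input distribution `P`: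
`max_{ℓ∈[0,1]} −Σ_x P(x) log( Σ_z W(z|x)^ℓ W'(z|x)^{1−ℓ} )`. -/
noncomputable def chernoffPair [Fintype 𝒳] [Fintype 𝒵] (P : 𝒳 → ℝ) (W W' : 𝒳 → 𝒵 → ℝ) : ℝ :=
  sSup ((fun ℓ => -∑ x, P x * Real.log (chernoffSum (W x) (W' x) ℓ)) '' Set.Icc (0 : ℝ) 1)

/-- `ψ_s(P) = min_{s' ≠ s} (Chernoff information between `W_s` and `W_{s'}` under `P`)`. -/
noncomputable def psi [Fintype 𝒳] [Fintype 𝒵] (WZ : 𝒮 → 𝒳 → 𝒵 → ℝ) (P : 𝒳 → ℝ) (s : 𝒮) : ℝ :=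
  sInf ((fun s' => chernoffPair P (WZ s) (WZ s')) '' {s' : 𝒮 | s' ≠ s})

/-- Chernoff detection-error exponent `φ(P) = min_s ψ_s(P)`. -/
noncomputable def phi [Fintype 𝒳] [Fintype 𝒵] (WZ : 𝒮 → 𝒳 → 𝒵 → ℝ) (P : 𝒳 → ℝ) : ℝ :=
  ⨅ s, psi WZ P s

/-- Standing assumption: for all `s ≠ s'` the best Chernoff information is positive. -/
def StandingAssumption [Fintype 𝒳] [Fintype 𝒵] (WZ : 𝒮 → 𝒳 → 𝒵 → ℝ) : Prop :=
  ∀ s s' : 𝒮, s ≠ s' →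
    0 < sSup ((fun P => chernoffPair P (WZ s) (WZ s')) '' {P : 𝒳 → ℝ | IsPMF P})

/-- Empirical distribution (type) of a sequence `x ∈ 𝒳ⁿ`. -/
noncomputable def empDist [Fintype 𝒳] [DecidableEq 𝒳] {n : ℕ} (x : Fin n → 𝒳) (a : 𝒳) : ℝ :=
  (Finset.univ.filter (fun i => x i = a)).card / n

open Classical in
/-- Probability of an event `A` on `Yⁿ` when the codeword `x` is sent over the bi-static
channel in state `s`. -/
noncomputable def biProbEvent [Fintype 𝒴] {n : ℕ} (W : 𝒮 → 𝒳 → 𝒴 → ℝ)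
    (x : Fin n → 𝒳) (s : 𝒮) (A : (Fin n → 𝒴) → Prop) : ℝ :=
  ∑ y : Fin n → 𝒴, if A y then ∏ i, W s (x i) (y i) else 0

/-- `(R, E)` is an achievable rate / detection-error-exponent pair for the bi-static model. -/
def BiAchievable [Fintype 𝒳] [Fintype 𝒴] (W : 𝒮 → 𝒳 → 𝒴 → ℝ) (R E : ℝ) : Prop :=
  ∀ ε > (0 : ℝ), ∃ (n M : ℕ) (f : Fin M → Fin n → 𝒳)
      (g : (Fin n → 𝒴) → 𝒮) (h : (Fin n → 𝒴) → Fin M),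
    0 < n ∧ 0 < M ∧
    R - ε ≤ Real.log M / n ∧
    (∀ (s : 𝒮) (w : Fin M), biProbEvent W (f w) s (fun y => h y ≠ w) ≤ ε) ∧
    (∀ (s : 𝒮) (w : Fin M),
      biProbEvent W (f w) s (fun y => g y ≠ s) ≤ Real.exp (-(n : ℝ) * (E - ε)))

/-- `C^(b)`: closure of the set of achievable pairs in `ℝ₊²` for the bi-static model. -/
def Cbi [Fintype 𝒳] [Fintype 𝒴] (W : 𝒮 → 𝒳 → 𝒴 → ℝ) : Set (ℝ × ℝ) :=
  closure {p : ℝ × ℝ | 0 ≤ p.1 ∧ 0 ≤ p.2 ∧ BiAchievable W p.1 p.2}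

/-- Conditional entropy `H(Q | P)` (natural logarithm). -/
noncomputable def condH [Fintype 𝒳] [Fintype 𝒴] (P : 𝒳 → ℝ) (Q : 𝒳 → 𝒴 → ℝ) : ℝ :=
  -∑ x, ∑ y, P x * Q x y * Real.log (Q x y)

/-- Output distribution `(P ∘ Q)(y) = Σ_x P(x) Q(y|x)`. -/
noncomputable def outDist [Fintype 𝒳] (P : 𝒳 → ℝ) (Q : 𝒳 → 𝒴 → ℝ) (y : 𝒴) : ℝ :=
  ∑ x, P x * Q x y

/-- Shannon entropy of a distribution on `𝒴` (natural logarithm). -/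
noncomputable def ent [Fintype 𝒴] (Q : 𝒴 → ℝ) : ℝ := -∑ y, Q y * Real.log (Q y)

open Classical in
/-- Conditional relative entropy `D(Q ‖ V | P)`, equal to `+∞` when absolute continuity
fails. -/
noncomputable def condKL [Fintype 𝒳] [Fintype 𝒴] (P : 𝒳 → ℝ) (Q V : 𝒳 → 𝒴 → ℝ) : ℝ≥0∞ :=
  if ∀ x y, P x * Q x y ≠ 0 → V x y ≠ 0 then
    ENNReal.ofReal (∑ x, ∑ y, P x * Q x y * Real.log (Q x y / V x y))
  else ⊤

/-- Successive-scheme exponent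
`ρ_succ(P,R) = min_s inf_{Q} [ D(Q‖W_s|P) + |I(P,Q) − R|⁺ ]`, in `ℝ≥0∞`. -/
noncomputable def rhoSucc [Fintype 𝒳] [Fintype 𝒴] (W : 𝒮 → 𝒳 → 𝒴 → ℝ)
    (P : 𝒳 → ℝ) (R : ℝ) : ℝ≥0∞ :=
  ⨅ s, ⨅ Q ∈ {Q : 𝒳 → 𝒴 → ℝ | IsChannel Q},
    condKL P Q (W s) + ENNReal.ofReal (mutualInfo P Q - R)

/-- `β(Q,P,R,s)`: infimum of `D(Q''‖W_s|P) + H(Q''|P)` over channels `Q''` with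
`I(P,Q'') < R` and `P∘Q'' = P∘Q` (`+∞` if no such channel exists). -/
noncomputable def beta [Fintype 𝒳] [Fintype 𝒴] (W : 𝒮 → 𝒳 → 𝒴 → ℝ) (Q : 𝒳 → 𝒴 → ℝ)
    (P : 𝒳 → ℝ) (R : ℝ) (s : 𝒮) : ℝ≥0∞ :=
  ⨅ Q'' ∈ {Q'' : 𝒳 → 𝒴 → ℝ | IsChannel Q'' ∧ mutualInfo P Q'' < R ∧
      ∀ y, outDist P Q'' y = outDist P Q y},
    condKL P Q'' (W s) + ENNReal.ofReal (condH P Q'')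

/-- The set `P_{s,s'}(Q,P,R)` of conditional distributions. -/
def PSet [Fintype 𝒳] [Fintype 𝒴] (W : 𝒮 → 𝒳 → 𝒴 → ℝ) (Q : 𝒳 → 𝒴 → ℝ)
    (P : 𝒳 → ℝ) (R : ℝ) (s s' : 𝒮) : Set (𝒳 → 𝒴 → ℝ) :=
  {Q' | IsChannel Q' ∧
    condKL P Q' (W s') + ENNReal.ofReal (condH P Q')
      ≤ min (beta W Q P R s) (condKL P Q (W s) + ENNReal.ofReal (condH P Q)) ∧
    ∀ y, outDist P Q' y = outDist P Q y}

/-- Joint decoding-and-detection exponent `ρ_joint(P,R)`, in `ℝ≥0∞`; truncated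
subtraction implements `|·−R|⁺` and an infimum over an empty set is `+∞`. -/
noncomputable def rhoJoint [Fintype 𝒳] [Fintype 𝒴] (W : 𝒮 → 𝒳 → 𝒴 → ℝ)
    (P : 𝒳 → ℝ) (R : ℝ) : ℝ≥0∞ :=
  ⨅ s, ⨅ Q ∈ {Q : 𝒳 → 𝒴 → ℝ | IsChannel Q},
    condKL P Q (W s) +
      ((⨅ s' ∈ {s' : 𝒮 | s' ≠ s}, ⨅ Q' ∈ PSet W Q P R s s',
          ENNReal.ofReal (mutualInfo P Q')) - ENNReal.ofReal R)

/-- `γ₁(Q,R,s) = D(Q‖W_s|P) + |I(P,Q) − R|⁺`. -/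
noncomputable def gamma1 [Fintype 𝒳] [Fintype 𝒴] (W : 𝒮 → 𝒳 → 𝒴 → ℝ) (P : 𝒳 → ℝ)
    (Q : 𝒳 → 𝒴 → ℝ) (R : ℝ) (s : 𝒮) : ℝ≥0∞ :=
  condKL P Q (W s) + ENNReal.ofReal (mutualInfo P Q - R)

/-- `γ₂(Q,R,s) = D(Q‖W_s|P) + | D(Q‖W_s|P) + H(P∘Q) − β(Q,P,R,s) − R |⁺`. -/
noncomputable def gamma2 [Fintype 𝒳] [Fintype 𝒴] (W : 𝒮 → 𝒳 → 𝒴 → ℝ) (P : 𝒳 → ℝ)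
    (Q : 𝒳 → 𝒴 → ℝ) (R : ℝ) (s : 𝒮) : ℝ≥0∞ :=
  condKL P Q (W s) +
    ((condKL P Q (W s) + ENNReal.ofReal (ent (outDist P Q)) - beta W Q P R s)
      - ENNReal.ofReal R)

/-- `P'_{Y|X}(P,R,s)`: channels `Q` with `max_{s''} β(Q,P,R,s'') ≥ D(Q‖W_s|P) + H(Q|P)`. -/
def PsetPrime [Fintype 𝒳] [Fintype 𝒴] [Fintype 𝒮] (W : 𝒮 → 𝒳 → 𝒴 → ℝ) (P : 𝒳 → ℝ)
    (R : ℝ) (s : 𝒮) : Set (𝒳 → 𝒴 → ℝ) :=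
  {Q | IsChannel Q ∧
    condKL P Q (W s) + ENNReal.ofReal (condH P Q) ≤ ⨆ s'', beta W Q P R s''}

/-- `P''_{Y|X}(P,R,s)`: channels `Q` with `max_{s''} β(Q,P,R,s'') < D(Q‖W_s|P) + H(Q|P)`. -/
def PsetDoublePrime [Fintype 𝒳] [Fintype 𝒴] [Fintype 𝒮] (W : 𝒮 → 𝒳 → 𝒴 → ℝ) (P : 𝒳 → ℝ)
    (R : ℝ) (s : 𝒮) : Set (𝒳 → 𝒴 → ℝ) :=
  {Q | IsChannel Q ∧
    (⨆ s'', beta W Q P R s'') < condKL P Q (W s) + ENNReal.ofReal (condH P Q)}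

open Classical in
/-- Indicator of a proposition. -/
noncomputable def ind (p : Prop) : ℝ := if p then 1 else 0

lemma ind_of {p : Prop} (h : p) : ind p = 1 := by simp [ind, h]

lemma ind_not {p : Prop} (h : ¬ p) : ind p = 0 := by simp [ind, h]

lemma ind_nonneg (p : Prop) : 0 ≤ ind p := by unfold ind; split_ifs <;> norm_num

lemma ind_le_one (p : Prop) : ind p ≤ 1 := by unfold ind; split_ifs <;> norm_num

lemma ind_mono {p q : Prop} (h : p → q) : ind p ≤ ind q := by
  by_cases hp : p
  · rw [ind_of hp, ind_of (h hp)]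
  · rw [ind_not hp]; exact ind_nonneg q

lemma ind_or_le (p q : Prop) : ind (p ∨ q) ≤ ind p + ind q := by
  have hp := ind_nonneg p
  have hq := ind_nonneg q
  by_cases h : p
  · rw [ind_of h]; linarith [ind_le_one (p ∨ q)]
  · by_cases h' : q
    · rw [ind_of h']; linarith [ind_le_one (p ∨ q)]
    · rw [ind_not (by tauto)]; linarith

lemma ind_exists_mem_le {ι : Type*} (t : Finset ι) (p : ι → Prop) :
    ind (∃ i ∈ t, p i) ≤ ∑ i ∈ t, ind (p i) := by
  by_cases h : ∃ i ∈ t, p i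
  · obtain ⟨i, hi, hp⟩ := h
    calc ind _ ≤ 1 := ind_le_one _
      _ = ind (p i) := (ind_of hp).symm
      _ ≤ _ := Finset.single_le_sum (f := fun i => ind (p i)) (fun j _ => ind_nonneg _) hi
  · rw [ind_not h]; exact Finset.sum_nonneg fun j _ => ind_nonneg _

lemma ind_exists_le {ι : Type*} [Fintype ι] (p : ι → Prop) :
    ind (∃ i, p i) ≤ ∑ i, ind (p i) :=
  (ind_mono (by simp)).trans (ind_exists_mem_le Finset.univ p)

lemma ind_and (p q : Prop) : ind (p ∧ q) = ind p * ind q := by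
  by_cases hp : p <;> by_cases hq : q <;> simp [ind, hp, hq]

lemma sum_ind_eq_mul {α : Type*} [Fintype α] (a : α) (F : α → ℝ) :
    ∑ b, ind (b = a) * F b = F a := by
  classical
  simp [ind]

/-- Probability of the sequence `z` under a memoryless channel fed with `k`. -/
noncomputable def seqP {κ α : Type} {n : ℕ} (V : κ → α → ℝ) (k : Fin n → κ) (z : Fin n → α) : ℝ :=
  ∏ i, V (k i) (z i)

/-- Probability of the sequence `z` under the i.i.d. law with marginal `p`. -/
noncomputable def powP {α : Type} {n : ℕ} (p : α → ℝ) (z : Fin n → α) : ℝ := ∏ i, p (z i)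

lemma sum_prod_eq {ι α : Type*} [Fintype ι] [DecidableEq ι] [Fintype α] (q : ι → α → ℝ) :
    ∑ z : ι → α, ∏ i, q i (z i) = ∏ i, ∑ a, q i a :=
  (Fintype.prod_sum q).symm

lemma seqP_nonneg {κ α : Type} [Fintype α] {n : ℕ} {V : κ → α → ℝ} (hV : ∀ k a, 0 ≤ V k a)
    (k : Fin n → κ) (z : Fin n → α) : 0 ≤ seqP V k z :=
  Finset.prod_nonneg fun _ _ => hV _ _

lemma powP_nonneg {α : Type} {n : ℕ} {p : α → ℝ} (hp : ∀ a, 0 ≤ p a)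
    (z : Fin n → α) : 0 ≤ powP p z :=
  Finset.prod_nonneg fun _ _ => hp _

lemma sum_seqP {κ α : Type} [Fintype κ] [Fintype α] {n : ℕ} {V : κ → α → ℝ} (hV : IsChannel V)
    (k : Fin n → κ) : ∑ z, seqP V k z = 1 := by
  unfold seqP
  rw [sum_prod_eq (fun i a => V (k i) a)]
  exact Finset.prod_eq_one fun i _ => (hV (k i)).2

lemma isPMF_powP {α : Type} [Fintype α] {p : α → ℝ} (hp : IsPMF p) (n : ℕ) :
    IsPMF (powP p : (Fin n → α) → ℝ) := by
  refine ⟨fun z => powP_nonneg hp.1 z, ?_⟩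
  unfold powP
  rw [sum_prod_eq (fun _ a => p a)]
  exact Finset.prod_eq_one fun i _ => hp.2

/-- Joint empirical distribution of a pair of sequences. -/
noncomputable def emp {κ α : Type} {n : ℕ} (k : Fin n → κ) (z : Fin n → α) (c : κ) (a : α) : ℝ :=
  (∑ i, ind (k i = c ∧ z i = a)) / n

/-- Empirical distribution of a sequence. -/
noncomputable def marg {κ : Type} {n : ℕ} (k : Fin n → κ) (c : κ) : ℝ :=
  (∑ i, ind (k i = c)) / n

lemma emp_nonneg {κ α : Type} {n : ℕ} (k : Fin n → κ) (z : Fin n → α) (c : κ) (a : α) :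
    0 ≤ emp k z c a :=
  div_nonneg (Finset.sum_nonneg fun _ _ => ind_nonneg _) (Nat.cast_nonneg n)

lemma marg_nonneg {κ : Type} {n : ℕ} (k : Fin n → κ) (c : κ) : 0 ≤ marg k c :=
  div_nonneg (Finset.sum_nonneg fun _ _ => ind_nonneg _) (Nat.cast_nonneg n)

lemma emp_swap {κ α : Type} {n : ℕ} (k : Fin n → κ) (z : Fin n → α) (c : κ) (a : α) :
    emp k z c a = emp z k a c := by
  simp only [emp, and_comm]

lemma mul_sum_emp {κ α : Type} [Fintype κ] [Fintype α] {n : ℕ} (k : Fin n → κ) (z : Fin n → α)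
    (F : κ → α → ℝ) : n * ∑ c, ∑ a, emp k z c a * F c a = ∑ i, F (k i) (z i) := by
  classical
  rcases Nat.eq_zero_or_pos n with rfl | hn
  · simp
  have hn' : (n : ℝ) ≠ 0 := by positivity
  have h1 : ∀ i, F (k i) (z i) = ∑ c, ∑ a, ind (k i = c ∧ z i = a) * F c a := by
    intro i
    have : ∀ c a, ind (k i = c ∧ z i = a) * F c a
        = ind (c = k i) * (ind (a = z i) * F c a) := by
      intro c a
      rw [ind_and, mul_assoc, @eq_comm _ c, @eq_comm _ a]
    simp only [this, ← Finset.mul_sum, sum_ind_eq_mul]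
  simp only [h1]
  rw [Finset.sum_comm (s := (Finset.univ : Finset (Fin n))), Finset.mul_sum]
  refine Finset.sum_congr rfl fun c _ => ?_
  rw [Finset.sum_comm (s := (Finset.univ : Finset (Fin n))), Finset.mul_sum]
  refine Finset.sum_congr rfl fun a _ => ?_
  rw [← Finset.sum_mul, emp]
  field_simp

lemma sum_emp_right {κ α : Type} [Fintype α] {n : ℕ} (k : Fin n → κ) (z : Fin n → α) (c : κ) :
    ∑ a, emp k z c a = marg k c := by
  classical
  unfold emp marg
  rw [← Finset.sum_div, Finset.sum_comm]
  congr 1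
  refine Finset.sum_congr rfl fun i _ => ?_
  have : ∀ a, ind (k i = c ∧ z i = a) = ind (a = z i) * ind (k i = c) := by
    intro a; rw [ind_and, mul_comm, eq_comm]; simp only [eq_comm]
  simp only [this, sum_ind_eq_mul]

lemma marg_le_one {κ : Type} {n : ℕ} (k : Fin n → κ) (c : κ) : marg k c ≤ 1 := by
  unfold marg
  refine div_le_one_of_le₀ ?_ (Nat.cast_nonneg n)
  calc _ ≤ ∑ _i : Fin n, (1 : ℝ) := Finset.sum_le_sum fun _ _ => ind_le_one _
    _ = n := by simp

lemma emp_le_one {κ α : Type} [Fintype α] {n : ℕ} (k : Fin n → κ) (z : Fin n → α) (c : κ) (a : α) :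
    emp k z c a ≤ 1 := by
  refine le_trans ?_ (marg_le_one k c)
  rw [← sum_emp_right k z c]
  exact Finset.single_le_sum (f := fun a => emp k z c a) (fun b _ => emp_nonneg k z c b)
    (Finset.mem_univ a)

lemma exists_of_emp_pos {κ α : Type} {n : ℕ} {k : Fin n → κ} {z : Fin n → α} {c : κ} {a : α}
    (h : 0 < emp k z c a) : ∃ i, k i = c ∧ z i = a := by
  by_contra hcon
  push Not at hcon
  have : emp k z c a = 0 := by
    unfold emp
    rw [Finset.sum_eq_zero, zero_div]
    intro i _
    exact ind_not (by simpa using hcon i)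
  linarith

lemma emp_pos {κ α : Type} {n : ℕ} (k : Fin n → κ) (z : Fin n → α) (i : Fin n) :
    0 < emp k z (k i) (z i) := by
  have hn : (0 : ℝ) < n := by exact_mod_cast i.pos
  refine div_pos ?_ hn
  calc (0 : ℝ) < ind (k i = k i ∧ z i = z i) := by rw [ind_of ⟨rfl, rfl⟩]; norm_num
    _ ≤ _ := Finset.single_le_sum (f := fun j => ind (k j = k i ∧ z j = z i))
      (fun j _ => ind_nonneg _) (Finset.mem_univ i)

lemma seqP_eq_exp {κ α : Type} [Fintype κ] [Fintype α] {n : ℕ} {V : κ → α → ℝ}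
    {k : Fin n → κ} {z : Fin n → α} (h : ∀ i, 0 < V (k i) (z i)) :
    seqP V k z = Real.exp (n * ∑ c, ∑ a, emp k z c a * Real.log (V c a)) := by
  rw [mul_sum_emp k z (fun c a => Real.log (V c a)), Real.exp_sum]
  exact Finset.prod_congr rfl fun i _ => (Real.exp_log (h i)).symm

lemma pos_of_seqP_ne_zero {κ α : Type} {n : ℕ} {V : κ → α → ℝ} (hV : ∀ k a, 0 ≤ V k a)
    {k : Fin n → κ} {z : Fin n → α} (h : seqP V k z ≠ 0) (i : Fin n) : 0 < V (k i) (z i) :=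
  lt_of_le_of_ne (hV _ _) (Ne.symm (Finset.prod_ne_zero_iff.mp h i (Finset.mem_univ i)))

lemma pos_of_powP_ne_zero {α : Type} {n : ℕ} {p : α → ℝ} (hp : ∀ a, 0 ≤ p a)
    {z : Fin n → α} (h : powP p z ≠ 0) (i : Fin n) : 0 < p (z i) :=
  lt_of_le_of_ne (hp _) (Ne.symm (Finset.prod_ne_zero_iff.mp h i (Finset.mem_univ i)))

lemma continuous_sum_mul {κ α : Type} [Fintype κ] [Fintype α] (F : κ → α → ℝ) :
    Continuous fun J : κ → α → ℝ => ∑ c, ∑ a, J c a * F c a := by fun_prop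

/-- Local change-of-measure bound: sequences whose joint type is close to `J` have
exponentially small probability, with any exponent below `Σ J log (V / V₀)`. -/
lemma tilt_local {κ α : Type} [Fintype κ] [Fintype α] {V₀ V J : κ → α → ℝ}
    (hV₀ : IsChannel V₀) (hV : IsChannel V) (hJ : ∀ k a, 0 ≤ J k a)
    (hs : ∀ k a, J k a ≠ 0 → V₀ k a ≠ 0 ∧ V k a ≠ 0) (hsum : ∑ k, ∑ a, J k a = 1)
    {c : ℝ} (hc : c < ∑ k, ∑ a, J k a * Real.log (V k a / V₀ k a)) :
    ∃ U ∈ nhds J, ∀ (n : ℕ) (k : Fin n → κ),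
      ∑ z : Fin n → α, ind (emp k z ∈ U) * seqP V₀ k z ≤ Real.exp (-(n * c)) := by
  set S := ∑ k, ∑ a, J k a * Real.log (V k a / V₀ k a) with hS
  set r := Real.exp (-((S - c) / 2)) with hr
  have hr0 : 0 < r := Real.exp_pos _
  have hr1 : r < 1 := by rw [hr, Real.exp_lt_one_iff]; linarith
  have hlogr : Real.log r = -((S - c) / 2) := by rw [hr, Real.log_exp]
  let T : κ → α → ℝ := fun k a => r * V k a + (1 - r) * V₀ k a
  have hT0 : ∀ k a, 0 ≤ T k a := fun k a =>
    add_nonneg (mul_nonneg hr0.le ((hV k).1 a)) (mul_nonneg (by linarith) ((hV₀ k).1 a))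
  have hT : IsChannel T := fun k => ⟨hT0 k, by
    simp only [T, Finset.sum_add_distrib, ← Finset.mul_sum, (hV k).2, (hV₀ k).2]; ring⟩
  let L : κ → α → ℝ := fun k a => Real.log (T k a / V₀ k a)
  have hVT : ∀ k a, V₀ k a ≤ T k a * Real.exp (-L k a) := by
    intro k a
    rcases ((hV₀ k).1 a).eq_or_lt with h | h
    · rw [← h]; exact mul_nonneg (hT0 k a) (Real.exp_pos _).le
    · have hTp : 0 < T k a :=
        add_pos_of_nonneg_of_pos (mul_nonneg hr0.le ((hV k).1 a)) (mul_pos (by linarith) h)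
      have : Real.exp (-L k a) = (T k a / V₀ k a)⁻¹ := by
        rw [Real.exp_neg, Real.exp_log (div_pos hTp h)]
      rw [this]; field_simp; exact le_refl _
  have hcL : c < ∑ k, ∑ a, J k a * L k a := by
    have h1 : S + Real.log r ≤ ∑ k, ∑ a, J k a * L k a := by
      have h2 : S + Real.log r
          = ∑ k, ∑ a, J k a * (Real.log (V k a / V₀ k a) + Real.log r) := by
        simp only [mul_add, Finset.sum_add_distrib, ← Finset.sum_mul, hsum, one_mul, hS]
      rw [h2]
      refine Finset.sum_le_sum fun k _ => Finset.sum_le_sum fun a _ => ?_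
      by_cases h0 : J k a = 0
      · simp [h0]
      · refine mul_le_mul_of_nonneg_left ?_ (hJ k a)
        obtain ⟨h3, h4⟩ := hs k a h0
        have h5 : 0 < V₀ k a := lt_of_le_of_ne ((hV₀ k).1 a) (Ne.symm h3)
        have h6 : 0 < V k a := lt_of_le_of_ne ((hV k).1 a) (Ne.symm h4)
        rw [← Real.log_mul (by positivity) hr0.ne']
        refine Real.log_le_log (by positivity) ?_
        rw [div_mul_eq_mul_div]
        gcongr
        simp only [T]
        nlinarith
    rw [hlogr] at h1
    linarith
  refine ⟨{J' | c < ∑ k, ∑ a, J' k a * L k a},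
    (isOpen_lt continuous_const (continuous_sum_mul L)).mem_nhds hcL, fun n k => ?_⟩
  calc _ ≤ ∑ z : Fin n → α, seqP T k z * Real.exp (-(n * c)) := by
        refine Finset.sum_le_sum fun z _ => ?_
        by_cases hz : emp k z ∈ {J' | c < ∑ k, ∑ a, J' k a * L k a}
        · rw [ind_of hz, one_mul]
          have h1 : seqP V₀ k z ≤ ∏ i, (T (k i) (z i) * Real.exp (-L (k i) (z i))) :=
            Finset.prod_le_prod (fun i _ => (hV₀ _).1 _) fun i _ => hVT _ _
          rw [Finset.prod_mul_distrib, ← Real.exp_sum, Finset.sum_neg_distrib,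
            ← mul_sum_emp k z L] at h1
          refine h1.trans (mul_le_mul_of_nonneg_left ?_ (seqP_nonneg hT0 k z))
          refine Real.exp_le_exp.mpr (neg_le_neg ?_)
          exact mul_le_mul_of_nonneg_left (le_of_lt hz) (Nat.cast_nonneg n)
        · rw [ind_not hz, zero_mul]
          exact mul_nonneg (seqP_nonneg hT0 k z) (Real.exp_pos _).le
    _ = _ := by rw [← Finset.sum_mul, sum_seqP hT, one_mul]

lemma exists_sup_ball_subset {κ α : Type} [Fintype κ] [Fintype α] {J : κ → α → ℝ}
    {U : Set (κ → α → ℝ)} (hU : U ∈ nhds J) :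
    ∃ r > 0, ∀ J' : κ → α → ℝ, (∀ k a, |J' k a - J k a| < r) → J' ∈ U := by
  obtain ⟨r, hr, hsub⟩ := Metric.mem_nhds_iff.mp hU
  refine ⟨r, hr, fun J' h => hsub ?_⟩
  rw [Metric.mem_ball, dist_pi_lt_iff hr]
  intro k
  rw [dist_pi_lt_iff hr]
  exact fun a => h k a

/-- Exponential concentration for sums of independent centred variables bounded by one. -/
lemma conc {α : Type} [Fintype α] {n : ℕ} {q F : Fin n → α → ℝ} (hq : ∀ i, IsPMF (q i))
    (hF : ∀ i a, |F i a| ≤ 1) (hm : ∀ i, ∑ a, q i a * F i a = 0)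
    {δ : ℝ} (hδ0 : 0 ≤ δ) (hδ2 : δ ≤ 2) :
    ∑ z : Fin n → α, ind (n * δ ≤ ∑ i, F i (z i)) * ∏ i, q i (z i)
      ≤ Real.exp (-(n * (δ ^ 2 / 4))) := by
  have h1 : ∀ i, ∑ a, q i a * Real.exp (δ / 2 * F i a) ≤ Real.exp ((δ / 2) ^ 2) := by
    intro i
    calc ∑ a, q i a * Real.exp (δ / 2 * F i a)
        ≤ ∑ a, (q i a + δ / 2 * (q i a * F i a) + q i a * (δ / 2) ^ 2) := by
          refine Finset.sum_le_sum fun a _ => ?_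
          have hb : |δ / 2 * F i a| ≤ δ / 2 := by
            rw [abs_mul, abs_of_nonneg (by linarith)]
            exact mul_le_of_le_one_right (by linarith) (hF i a)
          have h2 := Real.abs_exp_sub_one_sub_id_le (x := δ / 2 * F i a) (by linarith)
          have h3 : (δ / 2 * F i a) ^ 2 ≤ (δ / 2) ^ 2 := by
            rw [← sq_abs]; exact pow_le_pow_left₀ (abs_nonneg _) hb 2
          have h4 := (abs_le.mp h2).2
          have h5 := mul_le_mul_of_nonneg_left
            (show Real.exp (δ / 2 * F i a) ≤ 1 + δ / 2 * F i a + (δ / 2) ^ 2 by linarith)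
            ((hq i).1 a)
          linarith
      _ = 1 + (δ / 2) ^ 2 := by
          rw [Finset.sum_add_distrib, Finset.sum_add_distrib, ← Finset.mul_sum, ← Finset.sum_mul,
            hm, (hq i).2]
          ring
      _ ≤ _ := by linarith [Real.add_one_le_exp ((δ / 2) ^ 2)]
  calc _ ≤ ∑ z : Fin n → α, Real.exp (-(n * (δ ^ 2 / 2)))
          * ∏ i, (q i (z i) * Real.exp (δ / 2 * F i (z i))) := by
        refine Finset.sum_le_sum fun z _ => ?_
        rw [Finset.prod_mul_distrib, ← Real.exp_sum, ← Finset.mul_sum, mul_left_comm,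
          ← Real.exp_add, mul_comm]
        refine mul_le_mul_of_nonneg_left ?_ (Finset.prod_nonneg fun i _ => (hq i).1 _)
        by_cases h : n * δ ≤ ∑ i, F i (z i)
        · rw [ind_of h]
          refine Real.one_le_exp ?_
          nlinarith
        · rw [ind_not h]; exact (Real.exp_pos _).le
    _ = Real.exp (-(n * (δ ^ 2 / 2))) * ∏ i, ∑ a, q i a * Real.exp (δ / 2 * F i a) := by
        rw [← Finset.mul_sum, sum_prod_eq (fun i a => q i a * Real.exp (δ / 2 * F i a))]
    _ ≤ Real.exp (-(n * (δ ^ 2 / 2))) * ∏ _i : Fin n, Real.exp ((δ / 2) ^ 2) := by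
        refine mul_le_mul_of_nonneg_left ?_ (Real.exp_pos _).le
        exact Finset.prod_le_prod (fun i _ => Finset.sum_nonneg fun a _ =>
          mul_nonneg ((hq i).1 a) (Real.exp_pos _).le) fun i _ => h1 i
    _ = _ := by
        rw [Finset.prod_const, ← Real.exp_nat_mul, ← Real.exp_add]
        congr 1
        simp
        ring

/-- Two-sided version of `conc`. -/
lemma conc_abs {α : Type} [Fintype α] {n : ℕ} {q F : Fin n → α → ℝ} (hq : ∀ i, IsPMF (q i))
    (hF : ∀ i a, |F i a| ≤ 1) (hm : ∀ i, ∑ a, q i a * F i a = 0)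
    {δ : ℝ} (hδ0 : 0 ≤ δ) (hδ2 : δ ≤ 2) :
    ∑ z : Fin n → α, ind (δ < |(∑ i, F i (z i)) / n|) * ∏ i, q i (z i)
      ≤ 2 * Real.exp (-(n * (δ ^ 2 / 4))) := by
  have h1 := conc hq hF hm hδ0 hδ2
  have h2 := conc (F := fun i a => -F i a) hq (fun i a => by rw [abs_neg]; exact hF i a)
    (fun i => by simp [hm i]) hδ0 hδ2
  refine le_trans ?_ ((add_le_add h1 h2).trans_eq (by ring))
  rw [← Finset.sum_add_distrib]
  refine Finset.sum_le_sum fun z _ => ?_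
  rw [← add_mul]
  refine mul_le_mul_of_nonneg_right ?_ (Finset.prod_nonneg fun i _ => (hq i).1 _)
  refine le_trans (ind_mono fun h => ?_) (ind_or_le _ _)
  rcases Nat.eq_zero_or_pos n with rfl | hn
  · left; simp
  have hn' : (0 : ℝ) < n := by exact_mod_cast hn
  rw [abs_div, abs_of_pos hn', lt_div_iff₀ hn'] at h
  rcases le_abs'.mp h.le with h | h
  · right; rw [Finset.sum_neg_distrib]; linarith
  · left; linarith

lemma abs_ind_sub_le_one (p : Prop) {t : ℝ} (h0 : 0 ≤ t) (h1 : t ≤ 1) : |ind p - t| ≤ 1 := by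
  rw [abs_le]
  constructor <;> linarith [ind_nonneg p, ind_le_one p]

lemma IsPMF.le_one {α : Type} [Fintype α] {p : α → ℝ} (hp : IsPMF p) (a : α) : p a ≤ 1 := by
  rw [← hp.2]
  exact Finset.single_le_sum (fun b _ => hp.1 b) (Finset.mem_univ a)

lemma sum_mul_ind_sub {α : Type} [Fintype α] {p : α → ℝ} (hp : IsPMF p) (a : α) :
    ∑ b, p b * (ind (b = a) - p a) = 0 := by
  have h := sum_ind_eq_mul a p
  simp only [mul_sub, Finset.sum_sub_distrib, ← Finset.sum_mul, hp.2, one_mul]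
  simp only [mul_comm (p _), h, sub_self]

lemma conc_emp {κ α : Type} [Fintype κ] [Fintype α] {V : κ → α → ℝ} (hV : IsChannel V)
    {n : ℕ} (k : Fin n → κ) {δ : ℝ} (hδ0 : 0 ≤ δ) (hδ2 : δ ≤ 2) :
    ∑ z : Fin n → α, ind (∃ c a, δ < |emp k z c a - marg k c * V c a|) * seqP V k z
      ≤ Fintype.card κ * Fintype.card α * (2 * Real.exp (-(n * (δ ^ 2 / 4)))) := by
  have h1 : ∀ c a, ∑ z : Fin n → α, ind (δ < |emp k z c a - marg k c * V c a|) * seqP V k z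
      ≤ 2 * Real.exp (-(n * (δ ^ 2 / 4))) := by
    intro c a
    have := conc_abs (q := fun i => V (k i)) (F := fun i b => ind (k i = c) * (ind (b = a) - V c a))
      (fun i => hV _) (fun i b => by
        rw [abs_mul, abs_of_nonneg (ind_nonneg _)]
        exact mul_le_one₀ (ind_le_one _) (abs_nonneg _)
          (abs_ind_sub_le_one _ ((hV c).1 a) ((hV c).le_one a)))
      (fun i => by
        by_cases hc : k i = c
        · simp only [hc, ind_of trivial, one_mul]; exact sum_mul_ind_sub (hV c) a
        · simp [ind_not hc]) hδ0 hδ2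
    refine le_of_eq_of_le (Finset.sum_congr rfl fun z _ => ?_) this
    unfold seqP
    congr 3
    simp only [mul_sub, Finset.sum_sub_distrib, ← Finset.sum_mul, ← ind_and, emp, marg]
    ring_nf
  calc _ ≤ ∑ z : Fin n → α,
        ∑ c, ∑ a, ind (δ < |emp k z c a - marg k c * V c a|) * seqP V k z := by
        refine Finset.sum_le_sum fun z _ => ?_
        simp only [← Finset.sum_mul]
        refine mul_le_mul_of_nonneg_right ?_ (seqP_nonneg (fun c => (hV c).1) k z)
        exact (ind_exists_le _).trans (Finset.sum_le_sum fun c _ => ind_exists_le _)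
    _ = ∑ c, ∑ a, ∑ z : Fin n → α, ind (δ < |emp k z c a - marg k c * V c a|) * seqP V k z := by
        rw [Finset.sum_comm]
        exact Finset.sum_congr rfl fun c _ => Finset.sum_comm
    _ ≤ ∑ _c : κ, ∑ _a : α, 2 * Real.exp (-(n * (δ ^ 2 / 4))) :=
        Finset.sum_le_sum fun c _ => Finset.sum_le_sum fun a _ => h1 c a
    _ = _ := by simp; ring

lemma conc_marg {α : Type} [Fintype α] {p : α → ℝ} (hp : IsPMF p)
    {n : ℕ} (hn : 0 < n) {δ : ℝ} (hδ0 : 0 ≤ δ) (hδ2 : δ ≤ 2) :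
    ∑ z : Fin n → α, ind (∃ a, δ < |marg z a - p a|) * powP p z
      ≤ Fintype.card α * (2 * Real.exp (-(n * (δ ^ 2 / 4)))) := by
  have h1 : ∀ a, ∑ z : Fin n → α, ind (δ < |marg z a - p a|) * powP p z
      ≤ 2 * Real.exp (-(n * (δ ^ 2 / 4))) := by
    intro a
    have := conc_abs (n := n) (q := fun _ => p) (F := fun _ b => ind (b = a) - p a)
      (fun i => hp) (fun i b => abs_ind_sub_le_one _ (hp.1 a) (hp.le_one a))
      (fun i => sum_mul_ind_sub hp a) hδ0 hδ2
    refine le_of_eq_of_le (Finset.sum_congr rfl fun z _ => ?_) this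
    unfold powP
    congr 3
    have hn' : (n : ℝ) ≠ 0 := by positivity
    simp [Finset.sum_sub_distrib, marg]
    field_simp
  calc _ ≤ ∑ z : Fin n → α, ∑ a, ind (δ < |marg z a - p a|) * powP p z := by
        refine Finset.sum_le_sum fun z _ => ?_
        rw [← Finset.sum_mul]
        exact mul_le_mul_of_nonneg_right (ind_exists_le _) (powP_nonneg hp.1 z)
    _ = ∑ a, ∑ z : Fin n → α, ind (δ < |marg z a - p a|) * powP p z := Finset.sum_comm
    _ ≤ ∑ _a : α, 2 * Real.exp (-(n * (δ ^ 2 / 4))) := Finset.sum_le_sum fun a _ => h1 a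
    _ = _ := by simp

lemma tendsto_exp_neg_nat_mul {c : ℝ} (hc : 0 < c) :
    Filter.Tendsto (fun n : ℕ => Real.exp (-(n * c))) Filter.atTop (nhds 0) := by
  refine Real.tendsto_exp_neg_atTop_nhds_zero.comp ?_
  exact tendsto_natCast_atTop_atTop.atTop_mul_const hc

/-- Strong typicality of a sequence. -/
def Typ {α : Type} {n : ℕ} (p : α → ℝ) (δ : ℝ) (x : Fin n → α) : Prop :=
  ∀ a, |marg x a - p a| ≤ δ

lemma not_typ_iff {α : Type} {n : ℕ} {p : α → ℝ} {δ : ℝ} {x : Fin n → α} :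
    ¬ Typ p δ x ↔ ∃ a, δ < |marg x a - p a| := by
  simp [Typ]

lemma tendsto_not_typ {α : Type} [Fintype α] {p : α → ℝ} (hp : IsPMF p) {δ : ℝ} (hδ : 0 < δ) :
    Filter.Tendsto (fun n : ℕ => ∑ z : Fin n → α, powP p z * ind (¬ Typ p δ z))
      Filter.atTop (nhds 0) := by
  set δ' := min δ 2 with hδ'
  have h0 : 0 < δ' := lt_min hδ two_pos
  have h1 : Filter.Tendsto (fun n : ℕ => Fintype.card α * (2 * Real.exp (-(n * (δ' ^ 2 / 4)))))
      Filter.atTop (nhds 0) := by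
    have := ((tendsto_exp_neg_nat_mul (c := δ' ^ 2 / 4) (by positivity)).const_mul 2).const_mul
      (Fintype.card α : ℝ)
    simpa using this
  refine tendsto_of_tendsto_of_tendsto_of_le_of_le' tendsto_const_nhds h1
    (Filter.Eventually.of_forall fun n => Finset.sum_nonneg fun z _ =>
      mul_nonneg (powP_nonneg hp.1 z) (ind_nonneg _)) ?_
  filter_upwards [Filter.eventually_gt_atTop 0] with n hn
  refine le_trans (Finset.sum_le_sum fun z _ => ?_) (conc_marg hp hn h0.le (min_le_right _ _))
  rw [mul_comm, not_typ_iff]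
  refine mul_le_mul_of_nonneg_right (ind_mono ?_) (powP_nonneg hp.1 z)
  rintro ⟨a, ha⟩
  exact ⟨a, lt_of_le_of_lt (min_le_left _ _) ha⟩

lemma tendsto_emp_not_mem {κ α : Type} [Fintype κ] [Fintype α] {p : κ → ℝ} (hp : IsPMF p)
    {V : κ → α → ℝ} (hV : IsChannel V) {U : Set (κ → α → ℝ)}
    (hU : U ∈ nhds fun k a => p k * V k a) :
    Filter.Tendsto (fun n : ℕ => ∑ x : Fin n → κ, powP p x *
      ∑ y : Fin n → α, ind (emp x y ∉ U) * seqP V x y) Filter.atTop (nhds 0) := by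
  obtain ⟨r, hr, hrU⟩ := exists_sup_ball_subset hU
  set δ := min (r / 3) 2 with hδ
  have h0 : 0 < δ := lt_min (by linarith) two_pos
  have h1 : Filter.Tendsto (fun n : ℕ => (∑ z : Fin n → κ, powP p z * ind (¬ Typ p δ z))
      + Fintype.card κ * Fintype.card α * (2 * Real.exp (-(n * (δ ^ 2 / 4)))))
      Filter.atTop (nhds 0) := by
    have := (((tendsto_exp_neg_nat_mul (c := δ ^ 2 / 4) (by positivity)).const_mul 2).const_mul
      (Fintype.card κ * Fintype.card α : ℝ))
    simpa using (tendsto_not_typ hp h0).add this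
  have hVn : ∀ k a, 0 ≤ V k a := fun k => (hV k).1
  refine tendsto_of_tendsto_of_tendsto_of_le_of_le tendsto_const_nhds h1
    (fun n => Finset.sum_nonneg fun z _ =>
      mul_nonneg (powP_nonneg hp.1 z) (Finset.sum_nonneg fun y _ => mul_nonneg (ind_nonneg _)
        (seqP_nonneg hVn _ _))) fun n => ?_
  set B := (Fintype.card κ * Fintype.card α * (2 * Real.exp (-(n * (δ ^ 2 / 4)))) : ℝ) with hB
  have h2 : ∀ x : Fin n → κ, ∑ y : Fin n → α, ind (emp x y ∉ U) * seqP V x y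
      ≤ ind (¬ Typ p δ x) + B := by
    intro x
    refine le_trans ?_ (add_le_add (le_refl _) (conc_emp hV x h0.le (min_le_right _ _)))
    rw [← mul_one (ind (¬ Typ p δ x)), ← sum_seqP hV x, Finset.mul_sum, ← Finset.sum_add_distrib]
    refine Finset.sum_le_sum fun y _ => ?_
    rw [← add_mul]
    refine mul_le_mul_of_nonneg_right ?_ (seqP_nonneg hVn _ _)
    refine le_trans (ind_mono fun h => ?_) (ind_or_le _ _)
    by_contra hcon
    push Not at hcon
    obtain ⟨ht, hb⟩ := hcon
    refine h (hrU _ fun k a => ?_)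
    have h3 := ht k
    have h4 := hb k a
    have hr3 : δ ≤ r / 3 := min_le_left _ _
    have h5 : |marg x k * V k a - p k * V k a| ≤ r / 3 := by
      rw [← sub_mul, abs_mul, abs_of_nonneg (hVn k a)]
      have := mul_le_of_le_one_right (abs_nonneg (marg x k - p k)) ((hV k).le_one a)
      linarith
    have h6 := abs_sub_le (emp x y k a) (marg x k * V k a) (p k * V k a)
    linarith
  calc _ ≤ ∑ x : Fin n → κ, (powP p x * ind (¬ Typ p δ x) + powP p x * B) := by
        refine Finset.sum_le_sum fun x _ => ?_
        rw [← mul_add]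
        exact mul_le_mul_of_nonneg_left (h2 x) (powP_nonneg hp.1 x)
    _ = _ := by rw [Finset.sum_add_distrib, ← Finset.sum_mul, (isPMF_powP hp n).2, one_mul]

/-- Expectation over a random codebook with i.i.d. codewords of law `p`. -/
noncomputable def EC {β : Type} [Fintype β] {M : ℕ} (p : β → ℝ) (F : (Fin M → β) → ℝ) : ℝ :=
  ∑ C : Fin M → β, (∏ w, p (C w)) * F C

lemma EC_mono {β : Type} [Fintype β] {M : ℕ} {p : β → ℝ} (hp : ∀ b, 0 ≤ p b)
    {F G : (Fin M → β) → ℝ} (h : ∀ C, (∀ w, p (C w) ≠ 0) → F C ≤ G C) : EC p F ≤ EC p G := by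
  refine Finset.sum_le_sum fun C _ => ?_
  by_cases h0 : ∏ w, p (C w) = 0
  · simp [h0]
  · exact mul_le_mul_of_nonneg_left
      (h C fun w => Finset.prod_ne_zero_iff.mp h0 w (Finset.mem_univ w))
      (Finset.prod_nonneg fun w _ => hp _)

lemma EC_const {β : Type} [Fintype β] {M : ℕ} {p : β → ℝ} (hp : IsPMF p) (c : ℝ) :
    EC (M := M) p (fun _ => c) = c := by
  unfold EC
  rw [← Finset.sum_mul, sum_prod_eq (fun _ b => p b), Finset.prod_eq_one fun i _ => hp.2, one_mul]

lemma EC_add {β : Type} [Fintype β] {M : ℕ} (p : β → ℝ) (F G : (Fin M → β) → ℝ) :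
    EC p (fun C => F C + G C) = EC p F + EC p G := by
  simp only [EC, mul_add, Finset.sum_add_distrib]

lemma EC_mul_left {β : Type} [Fintype β] {M : ℕ} (p : β → ℝ) (c : ℝ) (F : (Fin M → β) → ℝ) :
    EC p (fun C => c * F C) = c * EC p F := by
  simp only [EC, Finset.mul_sum, mul_left_comm]

lemma EC_sum {ι : Type*} {β : Type} [Fintype β] {M : ℕ} (p : β → ℝ) (t : Finset ι)
    (F : ι → (Fin M → β) → ℝ) :
    EC p (fun C => ∑ i ∈ t, F i C) = ∑ i ∈ t, EC p (F i) := by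
  simp only [EC, Finset.mul_sum]
  exact Finset.sum_comm

lemma exists_le_of_EC_le {β : Type} [Fintype β] {M : ℕ} {p : β → ℝ} (hp : IsPMF p)
    {F : (Fin M → β) → ℝ} {c : ℝ} (h : EC p F < c) : ∃ C, F C < c := by
  by_contra hcon
  push Not at hcon
  have := EC_mono (M := M) hp.1 (F := fun _ => c) (G := F) fun C _ => hcon C
  rw [EC_const hp] at this
  linarith

/-- Conditionally on the codeword `C w`, the other codewords are independent. -/
lemma EC_prod {β : Type} [Fintype β] {M : ℕ} (p : β → ℝ) (w : Fin M)
    (F : β → ℝ) (G : β → Fin M → β → ℝ) :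
    EC p (fun C => F (C w) * ∏ v ∈ Finset.univ.erase w, G (C w) v (C v))
      = ∑ a, p a * (F a * ∏ v ∈ Finset.univ.erase w, ∑ b, p b * G a v b) := by
  have key : ∀ (H : Fin M → β → ℝ), ∑ C : Fin M → β, H w (C w) *
      ∏ v ∈ Finset.univ.erase w, H v (C v) = (∑ b, H w b) *
      ∏ v ∈ Finset.univ.erase w, ∑ b, H v b := by
    intro H
    rw [Finset.mul_prod_erase Finset.univ (fun v => ∑ b, H v b) (Finset.mem_univ w),
      ← sum_prod_eq]
    exact Finset.sum_congr rfl fun C _ =>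
      Finset.mul_prod_erase Finset.univ (fun v => H v (C v)) (Finset.mem_univ w)
  unfold EC
  have h1 : ∀ C : Fin M → β,
      (∏ v, p (C v)) * (F (C w) * ∏ v ∈ Finset.univ.erase w, G (C w) v (C v))
      = ∑ a, (ind (C w = a) * (p a * F a)) *
        ∏ v ∈ Finset.univ.erase w, (p (C v) * G a v (C v)) := by
    intro C
    have h2 := sum_ind_eq_mul (C w) (fun a => (p a * F a) *
        ∏ v ∈ Finset.univ.erase w, (p (C v) * G a v (C v)))
    simp only [@eq_comm _ (C w), mul_assoc] at h2 ⊢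
    rw [h2, Finset.prod_mul_distrib,
      ← Finset.mul_prod_erase Finset.univ (fun v => p (C v)) (Finset.mem_univ w)]
    ring
  simp only [h1]
  rw [Finset.sum_comm]
  refine Finset.sum_congr rfl fun a _ => ?_
  have h3 := key (fun v b => if v = w then ind (b = a) * (p a * F a) else p b * G a v b)
  have h4 : ∀ (K : Fin M → ℝ) (K' : Fin M → ℝ), ∏ v ∈ Finset.univ.erase w,
      (if v = w then K v else K' v) = ∏ v ∈ Finset.univ.erase w, K' v := by
    intro K K'
    refine Finset.prod_congr rfl fun v hv => ?_
    rw [if_neg (Finset.ne_of_mem_erase hv)]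
  simp only [h4, if_true] at h3
  rw [h3, sum_ind_eq_mul a fun _ => p a * F a, mul_assoc]
  congr 2
  exact Finset.prod_congr rfl fun v hv => Finset.sum_congr rfl fun b _ =>
    if_neg (Finset.ne_of_mem_erase hv)

lemma EC_single {β : Type} [Fintype β] {M : ℕ} {p : β → ℝ} (hp : IsPMF p) (w : Fin M)
    (F : β → ℝ) : EC p (fun C => F (C w)) = ∑ a, p a * F a := by
  have := EC_prod p w F (fun _ _ _ => 1)
  simpa [hp.2] using this

lemma EC_pair {β : Type} [Fintype β] {M : ℕ} {p : β → ℝ} (hp : IsPMF p) {w w' : Fin M}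
    (hw : w' ≠ w) (F : β → β → ℝ) :
    EC p (fun C => F (C w) (C w')) = ∑ a, p a * ∑ b, p b * F a b := by
  have := EC_prod p w (fun _ => 1) (fun a v b => if v = w' then F a b else 1)
  have h2 : ∀ K : ℝ, ∏ v ∈ Finset.univ.erase w, (if v = w' then K else 1) = K := by
    intro K
    rw [Finset.prod_ite_eq' (Finset.univ.erase w) w' (fun _ => K)]
    simp [hw]
  have h3 : ∀ K : Fin M → ℝ, ∏ v ∈ Finset.univ.erase w, (if v = w' then K v else 1) = K w' := by
    intro K
    rw [Finset.prod_ite_eq' (Finset.univ.erase w) w' K]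
    simp [hw]
  have h4 : ∀ a v, ∑ b, p b * (if v = w' then F a b else 1)
      = if v = w' then ∑ b, p b * F a b else 1 := by
    intro a v
    split_ifs
    · rfl
    · simp [hp.2]
  simp only [h4, h3, one_mul] at this
  exact this

lemma pow0_nonneg {a : ℝ} (ha : 0 ≤ a) (l : ℝ) : 0 ≤ pow0 a l := by
  unfold pow0
  split_ifs
  · exact le_refl _
  · exact Real.rpow_nonneg ha l

lemma prod_pow0 {n : ℕ} (f : Fin n → ℝ) (hf : ∀ i, 0 ≤ f i) (l : ℝ) :
    ∏ i, pow0 (f i) l = pow0 (∏ i, f i) l := by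
  by_cases h : ∏ i, f i = 0
  · obtain ⟨i, hi, h0⟩ := Finset.prod_eq_zero_iff.mp h
    rw [pow0, if_pos h]
    exact Finset.prod_eq_zero hi (by rw [pow0, if_pos h0])
  · rw [pow0, if_neg h, ← Real.finsetProd_rpow _ _ fun i _ => hf i]
    refine Finset.prod_congr rfl fun i hi => ?_
    rw [pow0, if_neg (Finset.prod_ne_zero_iff.mp h i hi)]

lemma ind_le_mul_pow0 {a b l : ℝ} (ha : 0 ≤ a) (hb : 0 ≤ b) (hl : l ∈ Set.Icc (0 : ℝ) 1) :
    ind (a ≤ b) * a ≤ pow0 a l * pow0 b (1 - l) := by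
  rcases ha.eq_or_lt with h | h
  · rw [← h, mul_zero]; exact mul_nonneg (pow0_nonneg le_rfl l) (pow0_nonneg hb _)
  by_cases hab : a ≤ b
  · rw [ind_of hab, one_mul, pow0, pow0, if_neg h.ne', if_neg (h.trans_le hab).ne']
    calc a = a ^ l * a ^ (1 - l) := by
          rw [← Real.rpow_add h]; simp
      _ ≤ _ := by
          refine mul_le_mul_of_nonneg_left ?_ (Real.rpow_nonneg ha l)
          exact Real.rpow_le_rpow ha hab (by linarith [hl.2])
  · rw [ind_not hab, zero_mul]; exact mul_nonneg (pow0_nonneg ha l) (pow0_nonneg hb _)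

/-- Chernoff bound for two hypotheses on a known codeword. -/
lemma chernoff_bound {κ α : Type} [Fintype κ] [Fintype α] {V V' : κ → α → ℝ}
    (hV : ∀ k a, 0 ≤ V k a) (hV' : ∀ k a, 0 ≤ V' k a) {l : ℝ} (hl : l ∈ Set.Icc (0 : ℝ) 1)
    {n : ℕ} (x : Fin n → κ) :
    ∑ y : Fin n → α, ind (seqP V x y ≤ seqP V' x y) * seqP V x y
      ≤ Real.exp (n * ∑ c, marg x c * Real.log (chernoffSum (V c) (V' c) l)) := by
  have hC : ∀ c, 0 ≤ chernoffSum (V c) (V' c) l := fun c => Finset.sum_nonneg fun a _ =>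
    mul_nonneg (pow0_nonneg (hV c a) _) (pow0_nonneg (hV' c a) _)
  have h1 : n * ∑ c, marg x c * Real.log (chernoffSum (V c) (V' c) l)
      = ∑ i, Real.log (chernoffSum (V (x i)) (V' (x i)) l) := by
    have := mul_sum_emp x (fun _ => ()) (fun c _ => Real.log (chernoffSum (V c) (V' c) l))
    rw [← this]
    simp only [← Finset.sum_mul, sum_emp_right]
  calc _ ≤ ∑ y : Fin n → α, ∏ i, (pow0 (V (x i) (y i)) l * pow0 (V' (x i) (y i)) (1 - l)) := by
        refine Finset.sum_le_sum fun y _ => ?_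
        rw [Finset.prod_mul_distrib, prod_pow0 _ (fun i => hV _ _), prod_pow0 _ (fun i => hV' _ _)]
        exact ind_le_mul_pow0 (seqP_nonneg hV x y) (seqP_nonneg hV' x y) hl
    _ = ∏ i, chernoffSum (V (x i)) (V' (x i)) l :=
        sum_prod_eq (fun i a => pow0 (V (x i) a) l * pow0 (V' (x i) a) (1 - l))
    _ ≤ ∏ i, Real.exp (Real.log (chernoffSum (V (x i)) (V' (x i)) l)) :=
        Finset.prod_le_prod (fun i _ => hC _) fun i _ => Real.le_exp_log _
    _ = _ := by rw [← Real.exp_sum, h1]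

/-- Detection of the state from a known typical codeword has exponent at least any
number below the Chernoff information. -/
lemma chernoff_typ {κ α : Type} [Fintype κ] [Fintype α] {V V' : κ → α → ℝ}
    (hV : ∀ k a, 0 ≤ V k a) (hV' : ∀ k a, 0 ≤ V' k a) {P : κ → ℝ} {c : ℝ}
    (hc : c < chernoffPair P V V') :
    ∀ᶠ δ in nhdsWithin (0 : ℝ) (Set.Ioi 0), ∀ (n : ℕ) (x : Fin n → κ), Typ P δ x →
      ∑ y : Fin n → α, ind (seqP V x y ≤ seqP V' x y) * seqP V x y ≤ Real.exp (-(n * c)) := by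
  obtain ⟨_, ⟨l, hl, rfl⟩, hlt⟩ := exists_lt_of_lt_csSup
    ((Set.nonempty_Icc.mpr zero_le_one).image _) hc
  set g : κ → ℝ := fun c => Real.log (chernoffSum (V c) (V' c) l) with hg
  have hlim : Filter.Tendsto (fun δ : ℝ => (∑ k, P k * g k) + δ * ∑ k, |g k|)
      (nhdsWithin 0 (Set.Ioi 0)) (nhds (∑ k, P k * g k)) := by
    have : Filter.Tendsto (fun δ : ℝ => (∑ k, P k * g k) + δ * ∑ k, |g k|) (nhds 0)
        (nhds ((∑ k, P k * g k) + 0 * ∑ k, |g k|)) :=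
      (Continuous.tendsto (by fun_prop) 0)
    simp only [zero_mul, add_zero] at this
    exact this.mono_left nhdsWithin_le_nhds
  have hlt' : ∑ k, P k * g k < -c := by
    simp only at hlt
    linarith
  filter_upwards [hlim.eventually (gt_mem_nhds hlt')] with δ hδ n x hx
  refine (chernoff_bound hV hV' hl x).trans (Real.exp_le_exp.mpr ?_)
  rw [← mul_neg]
  refine mul_le_mul_of_nonneg_left (le_trans ?_ hδ.le) (Nat.cast_nonneg n)
  rw [Finset.mul_sum, ← Finset.sum_add_distrib]
  refine Finset.sum_le_sum fun k _ => ?_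
  have h1 : (marg x k - P k) * g k ≤ δ * |g k| := by
    refine (le_abs_self _).trans ?_
    rw [abs_mul]
    exact mul_le_mul_of_nonneg_right (hx k) (abs_nonneg _)
  change marg x k * g k ≤ _
  linarith

/-- A memoryless channel draw reproduces the prescribed joint type up to `δ` with probability
at least one half, uniformly in the channel and in the conditioning sequence. -/
lemma half_le_sum_emp_close (κ α : Type) [Fintype κ] [Fintype α] {δ : ℝ} (hδ : 0 < δ) :
    ∀ᶠ n : ℕ in Filter.atTop, ∀ (V : κ → α → ℝ), IsChannel V → ∀ (k : Fin n → κ),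
      1 / 2 ≤ ∑ z : Fin n → α, ind (∀ c a, |emp k z c a - marg k c * V c a| ≤ δ) * seqP V k z := by
  set δ' := min δ 2 with hδ'
  have h0 : 0 < δ' := lt_min hδ two_pos
  have h1 : Filter.Tendsto (fun n : ℕ => Fintype.card κ * Fintype.card α *
      (2 * Real.exp (-(n * (δ' ^ 2 / 4))))) Filter.atTop (nhds (0 : ℝ)) := by
    have := ((tendsto_exp_neg_nat_mul (c := δ' ^ 2 / 4) (by positivity)).const_mul 2).const_mul
      (Fintype.card κ * Fintype.card α : ℝ)
    simpa using this
  filter_upwards [h1.eventually (gt_mem_nhds (show (0 : ℝ) < 1 / 2 by norm_num))] with n hn V hV k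
  have h2 := conc_emp hV k h0.le (min_le_right _ _)
  have h3 : (1 : ℝ) ≤
      (∑ z : Fin n → α, ind (∀ c a, |emp k z c a - marg k c * V c a| ≤ δ) * seqP V k z)
      + ∑ z : Fin n → α, ind (∃ c a, δ' < |emp k z c a - marg k c * V c a|) * seqP V k z := by
    rw [← sum_seqP hV k, ← Finset.sum_add_distrib]
    refine Finset.sum_le_sum fun z _ => ?_
    rw [← add_mul]
    refine le_mul_of_one_le_left (seqP_nonneg (fun c => (hV c).1) k z) ?_
    refine le_trans ?_ (ind_or_le _ _)
    rw [ind_of]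
    by_contra hcon
    push Not at hcon
    obtain ⟨⟨c, a, h4⟩, h5⟩ := hcon
    exact absurd ((h5 c a).trans (min_le_left _ _)) (not_le.mpr h4)
  linarith

/-- Covering: given an output sequence `y` whose joint type with some typical `x` is close to `J`,
an i.i.d. codeword is typical and has likelihood above `exp (-n θ)` with probability at least
`exp (-n I)`, as soon as some joint distribution `A` with the marginals of `J` has information
below `I` and cost below `θ`. -/
lemma covering_of_support {𝒳 𝒴 : Type} [Fintype 𝒳] [Fintype 𝒴] {P : 𝒳 → ℝ} (hP : IsPMF P)
    {W : 𝒳 → 𝒴 → ℝ} (hW : IsChannel W) {J A : 𝒳 → 𝒴 → ℝ}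
    (hJ : ∀ a b, 0 ≤ J a b) (hA : ∀ a b, 0 ≤ A a b)
    (hJX : ∀ a, ∑ b, J a b = P a) (hAX : ∀ a, ∑ b, A a b = P a)
    (hAY : ∀ b, ∑ a, A a b = ∑ a, J a b)
    (hAW : ∀ a b, A a b ≠ 0 → W a b ≠ 0) (hJA : ∀ a b, J a b ≠ 0 → A a b ≠ 0)
    {I θ : ℝ} (hI : ∑ a, ∑ b, A a b * Real.log (A a b / (P a * ∑ a', J a' b)) < I)
    (hθ : -∑ a, ∑ b, A a b * Real.log (W a b) < θ) :
    ∃ U ∈ nhds J, ∀ δ > 0, ∀ᶠ n : ℕ in Filter.atTop, ∀ (x : Fin n → 𝒳) (y : Fin n → 𝒴),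
      emp x y ∈ U → Typ P δ x → seqP W x y ≠ 0 → powP P x ≠ 0 →
      Real.exp (-(n * I)) ≤ ∑ x' : Fin n → 𝒳,
        powP P x' * ind (Typ P (2 * δ) x' ∧ Real.exp (-(n * θ)) < seqP W x' y) := by
  classical
  set JY : 𝒴 → ℝ := fun b => ∑ a', J a' b with hJY
  have hJYn : ∀ b, 0 ≤ JY b := fun b => Finset.sum_nonneg fun a _ => hJ a b
  have hAP : ∀ a b, A a b ≠ 0 → 0 < P a := fun a b h => by
    rw [← hAX a]
    exact (lt_of_le_of_ne (hA a b) (Ne.symm h)).trans_le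
      (Finset.single_le_sum (fun b _ => hA a b) (Finset.mem_univ b))
  have hAJY : ∀ a b, A a b ≠ 0 → 0 < JY b := fun a b h => by
    rw [hJY]; simp only; rw [← hAY b]
    exact (lt_of_le_of_ne (hA a b) (Ne.symm h)).trans_le
      (Finset.single_le_sum (f := fun a => A a b) (fun a _ => hA a b) (Finset.mem_univ a))
  let K : 𝒳 → 𝒴 → ℝ := fun a b => if JY b = 0 then 1 else A a b / JY b
  have hK0 : ∀ a b, 0 ≤ K a b := fun a b => by
    simp only [K]; split_ifs
    · norm_num
    · exact div_nonneg (hA a b) (hJYn b)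
  obtain ⟨I₁, hI₁, hI₁'⟩ := exists_between hI
  have hτ : ∃ τ > 0, ∑ a, ∑ b, A a b * Real.log ((K a b + τ) / P a) < I₁ := by
    have hc : ContinuousAt (fun τ : ℝ => ∑ a, ∑ b, A a b * Real.log ((K a b + τ) / P a)) 0 := by
      refine tendsto_finsetSum _ fun a _ => tendsto_finsetSum _ fun b _ => ?_
      by_cases h : A a b = 0
      · simp only [h, zero_mul]; exact tendsto_const_nhds
      · have h1 : 0 < K a b := by
          simp only [K]; rw [if_neg (hAJY a b h).ne']
          exact div_pos (lt_of_le_of_ne (hA a b) (Ne.symm h)) (hAJY a b h)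
        have h2 := hAP a b h
        have : ContinuousAt (fun τ : ℝ => A a b * Real.log ((K a b + τ) / P a)) 0 := by
          refine ContinuousAt.mul continuousAt_const (ContinuousAt.log ?_ ?_)
          · exact (continuousAt_const.add continuousAt_id).div_const _
          · simp only [add_zero]; positivity
        exact this
    have h0 : ∑ a, ∑ b, A a b * Real.log ((K a b + 0) / P a) < I₁ := by
      refine lt_of_eq_of_lt ?_ hI₁
      refine Finset.sum_congr rfl fun a _ => Finset.sum_congr rfl fun b _ => ?_
      by_cases h : A a b = 0
      · simp [h]
      · simp only [K]
        rw [if_neg (hAJY a b h).ne', add_zero, div_div, mul_comm (JY b)]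
    have h1 := hc.eventually (gt_mem_nhds h0)
    obtain ⟨τ, h2, h3⟩ := ((h1.filter_mono nhdsWithin_le_nhds).and
      (self_mem_nhdsWithin (s := Set.Ioi (0 : ℝ)))).exists
    exact ⟨τ, h3, h2⟩
  obtain ⟨τ, hτ0, hτI⟩ := hτ
  let L : 𝒳 → 𝒴 → ℝ := fun a b => Real.log ((K a b + τ) / P a)
  obtain ⟨r, hr, hrO⟩ := exists_sup_ball_subset (J := A)
    (U := {J' | ∑ a, ∑ b, J' a b * L a b < I₁} ∩
      {J' | -∑ a, ∑ b, J' a b * Real.log (W a b) < θ})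
    (Filter.inter_mem
      ((isOpen_lt (continuous_sum_mul L) continuous_const).mem_nhds hτI)
      ((isOpen_lt (continuous_sum_mul fun a b => Real.log (W a b)).neg
        continuous_const).mem_nhds hθ))
  have hev : ∀ᶠ J' in nhds J, ∀ a b, |J' a b - J a b| < r / 2 ∧
      (A a b ≠ 0 → 0 < A a b + (J' a b - J a b)) ∧
      (JY b ≠ 0 → 0 < ∑ a', J' a' b ∧ (A a b + (J' a b - J a b)) / (∑ a', J' a' b) < K a b + τ) := by
    rw [Filter.eventually_all]; intro a
    rw [Filter.eventually_all]; intro b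
    refine Filter.Eventually.and ?_ (Filter.Eventually.and ?_ ?_)
    · have : Continuous fun J' : 𝒳 → 𝒴 → ℝ => |J' a b - J a b| := by fun_prop
      refine this.continuousAt.eventually (gt_mem_nhds ?_)
      simpa using hr
    · by_cases h : A a b = 0
      · simp [h]
      · have : Continuous fun J' : 𝒳 → 𝒴 → ℝ => A a b + (J' a b - J a b) := by fun_prop
        refine (this.continuousAt.eventually (lt_mem_nhds ?_)).mono fun _ h' _ => h'
        simpa using lt_of_le_of_ne (hA a b) (Ne.symm h)
    · by_cases h : JY b = 0
      · simp [h]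
      · have hp : 0 < JY b := lt_of_le_of_ne (hJYn b) (Ne.symm h)
        have c1 : Continuous fun J' : 𝒳 → 𝒴 → ℝ => ∑ a', J' a' b := by fun_prop
        have c2 : ContinuousAt (fun J' : 𝒳 → 𝒴 → ℝ =>
            (A a b + (J' a b - J a b)) / (∑ a', J' a' b)) J := by
          refine ContinuousAt.div ?_ c1.continuousAt h
          exact Continuous.continuousAt (by fun_prop)
        refine ((c1.continuousAt.eventually (lt_mem_nhds hp)).and
          (c2.eventually (gt_mem_nhds ?_))).mono fun _ h' _ => h'
        simp only [sub_self, add_zero, K]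
        rw [if_neg h]
        simp only [hJY]
        linarith
  refine ⟨_, hev, fun δ hδ => ?_⟩
  have hcardpos : (0 : ℝ) < Fintype.card 𝒴 + 1 := by positivity
  set δ₁ := min (δ / (Fintype.card 𝒴 + 1)) (r / 2) with hδ₁
  have hδ₁0 : 0 < δ₁ := lt_min (by positivity) (by linarith)
  have hexp : ∀ᶠ n : ℕ in Filter.atTop, Real.exp (-(n * (I - I₁))) < 1 / 2 :=
    (tendsto_exp_neg_nat_mul (sub_pos.mpr hI₁')).eventually (gt_mem_nhds (by norm_num))
  filter_upwards [half_le_sum_emp_close 𝒴 𝒳 hδ₁0, hexp, Filter.eventually_gt_atTop 0]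
    with n hhalf hexpn hn x y hxy hx hWxy hPx
  have hnp : (0 : ℝ) < n := by exact_mod_cast hn
  set J' := emp x y with hJ'
  have hJ'n : ∀ a b, 0 ≤ J' a b := emp_nonneg x y
  have hJ'Y : ∀ b, ∑ a, J' a b = marg y b := fun b => by
    simp only [hJ', emp_swap x y]; exact sum_emp_right y x b
  have hJ'X : ∀ a, ∑ b, J' a b = marg x a := sum_emp_right x y
  let A' : 𝒳 → 𝒴 → ℝ := fun a b => A a b + (J' a b - J a b)
  have hA'n : ∀ a b, 0 ≤ A' a b := fun a b => by
    by_cases h : A a b = 0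
    · have h2 : J a b = 0 := by by_contra h3; exact hJA a b h3 h
      simp only [A', h, h2]; linarith [hJ'n a b]
    · exact ((hxy a b).2.1 h).le
  have hA'supp : ∀ a b, A' a b ≠ 0 → A a b ≠ 0 ∨ 0 < J' a b := fun a b h => by
    by_cases h1 : A a b = 0
    · right
      have h2 : J a b = 0 := by by_contra h3; exact hJA a b h3 h1
      refine lt_of_le_of_ne (hJ'n a b) (Ne.symm ?_)
      simpa [A', h1, h2] using h
    · exact Or.inl h1
  have hA'W : ∀ a b, A' a b ≠ 0 → 0 < W a b := fun a b h => by
    rcases hA'supp a b h with h | h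
    · exact lt_of_le_of_ne ((hW a).1 b) (Ne.symm (hAW a b h))
    · obtain ⟨i, rfl, rfl⟩ := exists_of_emp_pos h
      exact pos_of_seqP_ne_zero (fun a => (hW a).1) hWxy i
  have hA'P : ∀ a b, A' a b ≠ 0 → 0 < P a := fun a b h => by
    rcases hA'supp a b h with h | h
    · exact hAP a b h
    · obtain ⟨i, rfl, rfl⟩ := exists_of_emp_pos h
      exact pos_of_powP_ne_zero hP.1 hPx i
  have hA'Y : ∀ b, ∑ a, A' a b = marg y b := fun b => by
    simp only [A', Finset.sum_add_distrib, Finset.sum_sub_distrib, hAY, hJ'Y]; ring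
  have hA'X : ∀ a, ∑ b, A' a b = marg x a := fun a => by
    simp only [A', Finset.sum_add_distrib, Finset.sum_sub_distrib, hAX, hJX, hJ'X]; ring
  let K' : 𝒴 → 𝒳 → ℝ := fun b a => if marg y b = 0 then P a else A' a b / marg y b
  have hK' : IsChannel K' := fun b => by
    by_cases h : marg y b = 0
    · simp only [K', h, if_true]; exact hP
    · simp only [K', h, if_false]
      exact ⟨fun a => div_nonneg (hA'n a b) (marg_nonneg y b), by
        rw [← Finset.sum_div, hA'Y, div_self h]⟩
  have hmK' : ∀ b a, marg y b * K' b a = A' a b := fun b a => by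
    by_cases h : marg y b = 0
    · rw [h, zero_mul]
      have h1 := hA'Y b
      rw [h, Finset.sum_eq_zero_iff_of_nonneg fun a _ => hA'n a b] at h1
      exact (h1 a (Finset.mem_univ a)).symm
    · simp only [K', h, if_false]; field_simp
  have hgood : ∀ x' : Fin n → 𝒳, (∀ b a, |emp y x' b a - marg y b * K' b a| ≤ δ₁) →
      seqP K' y x' ≠ 0 →
      seqP K' y x' * Real.exp (-(n * I₁)) ≤ powP P x' ∧
        (Typ P (2 * δ) x' ∧ Real.exp (-(n * θ)) < seqP W x' y) := by
    intro x' hcl hne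
    have hclose : ∀ a b, |emp x' y a b - A' a b| ≤ δ₁ := fun a b => by
      rw [emp_swap x' y, ← hmK' b a]; exact hcl b a
    have hpos : ∀ i, 0 < A' (x' i) (y i) := fun i => by
      have h1 := pos_of_seqP_ne_zero (fun b => (hK' b).1) hne i
      rw [← hmK' (y i) (x' i)]
      refine mul_pos ?_ h1
      have h2 := emp_pos y y i
      rw [← sum_emp_right y y (y i)]
      exact h2.trans_le (Finset.single_le_sum (f := fun b => emp y y (y i) b)
        (fun b _ => emp_nonneg y y _ b) (Finset.mem_univ _))
    obtain ⟨hO1, hO2⟩ := hrO (emp x' y) fun a b => by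
      have h1 := hclose a b
      have h2 := (hxy a b).1
      have h3 : A' a b - A a b = J' a b - J a b := by simp only [A']; ring
      have h4 := abs_sub_le (emp x' y a b) (A' a b) (A a b)
      rw [h3] at h4
      have h5 : δ₁ ≤ r / 2 := min_le_right _ _
      linarith
    refine ⟨?_, fun a => ?_, ?_⟩
    · have h1 : seqP K' y x' ≤ ∏ i, (P (x' i) * Real.exp (L (x' i) (y i))) := by
        refine Finset.prod_le_prod (fun i _ => (hK' _).1 _) fun i _ => ?_
        have hPp := hA'P _ _ (hpos i).ne'
        have hKp : 0 < K (x' i) (y i) + τ := add_pos_of_nonneg_of_pos (hK0 _ _) hτ0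
        have h2 : P (x' i) * Real.exp (L (x' i) (y i)) = K (x' i) (y i) + τ := by
          simp only [L]
          rw [Real.exp_log (div_pos hKp hPp)]
          field_simp
        rw [h2]
        by_cases h3 : JY (y i) = 0
        · have h4 : K (x' i) (y i) = 1 := by simp only [K, h3, if_true]
          rw [h4]
          linarith [(hK' (y i)).le_one (x' i)]
        · obtain ⟨h5, h6⟩ := (hxy (x' i) (y i)).2.2 h3
          rw [hJ'Y] at h5 h6
          simp only [K', h5.ne', if_false]
          exact h6.le
      rw [Finset.prod_mul_distrib, ← Real.exp_sum, ← mul_sum_emp x' y L] at h1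
      have hPx' : 0 ≤ powP P x' := powP_nonneg hP.1 x'
      calc seqP K' y x' * Real.exp (-(n * I₁))
          ≤ powP P x' * Real.exp (n * ∑ a, ∑ b, emp x' y a b * L a b) * Real.exp (-(n * I₁)) :=
            mul_le_mul_of_nonneg_right h1 (Real.exp_pos _).le
        _ = powP P x' * Real.exp (n * ((∑ a, ∑ b, emp x' y a b * L a b) - I₁)) := by
            rw [mul_assoc, ← Real.exp_add]; congr 2; ring
        _ ≤ powP P x' * 1 := by
            refine mul_le_mul_of_nonneg_left ?_ hPx'
            rw [Real.exp_le_one_iff]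
            exact mul_nonpos_of_nonneg_of_nonpos hnp.le (sub_nonpos.mpr (le_of_lt hO1))
        _ = _ := mul_one _
    · have h1 : |marg x' a - marg x a| ≤ δ := by
        rw [← hA'X a, ← sum_emp_right x' y a, ← Finset.sum_sub_distrib]
        calc _ ≤ ∑ b, |emp x' y a b - A' a b| := Finset.abs_sum_le_sum_abs _ _
          _ ≤ ∑ _b : 𝒴, δ₁ := Finset.sum_le_sum fun b _ => hclose a b
          _ = Fintype.card 𝒴 * δ₁ := by simp
          _ ≤ Fintype.card 𝒴 * (δ / (Fintype.card 𝒴 + 1)) :=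
              mul_le_mul_of_nonneg_left (min_le_left _ _) (Nat.cast_nonneg _)
          _ ≤ δ := by
              rw [mul_div_assoc', div_le_iff₀ hcardpos]; nlinarith
      have h2 := hx a
      have h3 := abs_sub_le (marg x' a) (marg x a) (P a)
      linarith
    · rw [seqP_eq_exp fun i => hA'W _ _ (hpos i).ne']
      refine Real.exp_lt_exp.mpr ?_
      have hO2' : -∑ a, ∑ b, emp x' y a b * Real.log (W a b) < θ := hO2
      rw [← mul_neg]
      exact mul_lt_mul_of_pos_left (by linarith) hnp
  have hexp2 : Real.exp (-(n * I)) ≤ 1 / 2 * Real.exp (-(n * I₁)) := by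
    have : Real.exp (-(n * I)) = Real.exp (-(n * (I - I₁))) * Real.exp (-(n * I₁)) := by
      rw [← Real.exp_add]; congr 1; ring
    rw [this]
    exact mul_le_mul_of_nonneg_right hexpn.le (Real.exp_pos _).le
  refine hexp2.trans ((mul_le_mul_of_nonneg_right (hhalf K' hK' y) (Real.exp_pos _).le).trans ?_)
  rw [Finset.sum_mul]
  refine Finset.sum_le_sum fun x' _ => ?_
  have hPx' : 0 ≤ powP P x' := powP_nonneg hP.1 x'
  by_cases h1 : (∀ b a, |emp y x' b a - marg y b * K' b a| ≤ δ₁) ∧ seqP K' y x' ≠ 0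
  · obtain ⟨h2, h3⟩ := hgood x' h1.1 h1.2
    rw [ind_of h1.1, ind_of h3, one_mul, mul_one]
    exact h2
  · have h2 : ind (∀ b a, |emp y x' b a - marg y b * K' b a| ≤ δ₁) * seqP K' y x' = 0 := by
      by_cases h3 : ∀ b a, |emp y x' b a - marg y b * K' b a| ≤ δ₁
      · rw [show seqP K' y x' = 0 by by_contra h4; exact h1 ⟨h3, h4⟩, mul_zero]
      · rw [ind_not h3, zero_mul]
    rw [h2, zero_mul]
    exact mul_nonneg hPx' (ind_nonneg _)

/-- `covering_of_support` without the support condition. -/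
lemma covering {𝒳 𝒴 : Type} [Fintype 𝒳] [Fintype 𝒴] {P : 𝒳 → ℝ} (hP : IsPMF P)
    {W : 𝒳 → 𝒴 → ℝ} (hW : IsChannel W) {J A : 𝒳 → 𝒴 → ℝ}
    (hJ : ∀ a b, 0 ≤ J a b) (hA : ∀ a b, 0 ≤ A a b)
    (hJX : ∀ a, ∑ b, J a b = P a) (hAX : ∀ a, ∑ b, A a b = P a)
    (hAY : ∀ b, ∑ a, A a b = ∑ a, J a b)
    (hAW : ∀ a b, A a b ≠ 0 → W a b ≠ 0) (hJW : ∀ a b, J a b ≠ 0 → W a b ≠ 0)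
    {I θ : ℝ} (hI : ∑ a, ∑ b, A a b * Real.log (A a b / (P a * ∑ a', J a' b)) < I)
    (hθ : -∑ a, ∑ b, A a b * Real.log (W a b) < θ) :
    ∃ U ∈ nhds J, ∀ δ > 0, ∀ᶠ n : ℕ in Filter.atTop, ∀ (x : Fin n → 𝒳) (y : Fin n → 𝒴),
      emp x y ∈ U → Typ P δ x → seqP W x y ≠ 0 → powP P x ≠ 0 →
      Real.exp (-(n * I)) ≤ ∑ x' : Fin n → 𝒳,
        powP P x' * ind (Typ P (2 * δ) x' ∧ Real.exp (-(n * θ)) < seqP W x' y) := by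
  let B : ℝ → 𝒳 → 𝒴 → ℝ := fun t a b => (1 - t) * A a b + t * J a b
  have hzero : ∀ D : 𝒳 → 𝒴 → ℝ, (∀ a b, 0 ≤ D a b) → (∀ a, ∑ b, D a b = P a) →
      (∀ b, ∑ a, D a b = ∑ a, J a b) → ∀ a b, P a * ∑ a', J a' b = 0 → D a b = 0 := by
    intro D hD hDX hDY a b h
    rcases mul_eq_zero.mp h with h | h
    · rw [← hDX a, Finset.sum_eq_zero_iff_of_nonneg fun b _ => hD a b] at h
      exact h b (Finset.mem_univ b)
    · rw [← hDY b, Finset.sum_eq_zero_iff_of_nonneg fun a _ => hD a b] at h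
      exact h a (Finset.mem_univ a)
  have hBI : ∀ t a b, B t a b * Real.log (B t a b / (P a * ∑ a', J a' b))
      = B t a b * Real.log (B t a b) - B t a b * Real.log (P a * ∑ a', J a' b) := by
    intro t a b
    by_cases h0 : B t a b = 0
    · simp [h0]
    · rw [Real.log_div h0 fun h => h0 ?_, mul_sub]
      simp only [B, hzero A hA hAX hAY a b h, hzero J hJ hJX (fun _ => rfl) a b h]
      ring
  have c1 : Continuous fun t : ℝ =>
      ∑ a, ∑ b, B t a b * Real.log (B t a b / (P a * ∑ a', J a' b)) := by
    simp only [hBI]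
    refine continuous_finsetSum _ fun a _ => continuous_finsetSum _ fun b _ => ?_
    have c : Continuous fun t => B t a b := by simp only [B]; fun_prop
    exact (Real.continuous_mul_log.comp c).sub (c.mul continuous_const)
  have c2 : Continuous fun t : ℝ => -∑ a, ∑ b, B t a b * Real.log (W a b) := by
    simp only [B]; fun_prop
  have hB0 : B 0 = A := by funext a b; simp [B]
  have e1 : ∀ᶠ t : ℝ in nhds 0,
      ∑ a, ∑ b, B t a b * Real.log (B t a b / (P a * ∑ a', J a' b)) < I :=
    c1.continuousAt.eventually (gt_mem_nhds (by simpa only [hB0] using hI))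
  have e2 : ∀ᶠ t : ℝ in nhds 0, -∑ a, ∑ b, B t a b * Real.log (W a b) < θ :=
    c2.continuousAt.eventually (gt_mem_nhds (by simpa only [hB0] using hθ))
  have e3 : ∀ᶠ t : ℝ in nhds 0, t < 1 := gt_mem_nhds one_pos
  obtain ⟨t, ⟨⟨h1, h2⟩, h3⟩, h4⟩ := (((e1.and e2).and e3).filter_mono nhdsWithin_le_nhds |>.and
      (self_mem_nhdsWithin (s := Set.Ioi (0 : ℝ)))).exists
  have h4 : 0 < t := h4
  have h5 : 0 < 1 - t := by linarith
  refine covering_of_support hP hW (A := B t) hJ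
    (fun a b => add_nonneg (mul_nonneg h5.le (hA a b)) (mul_nonneg h4.le (hJ a b))) hJX
    (fun a => ?_) (fun b => ?_) (fun a b h => ?_) (fun a b h => ?_) h1 h2
  · simp only [B, Finset.sum_add_distrib, ← Finset.mul_sum, hAX, hJX]; ring
  · simp only [B, Finset.sum_add_distrib, ← Finset.mul_sum, hAY]; ring
  · by_cases h6 : A a b = 0
    · refine hJW a b fun h7 => h ?_
      simp [B, h6, h7]
    · exact hAW a b h6
  · have h6 : 0 < J a b := lt_of_le_of_ne (hJ a b) (Ne.symm h)
    have h7 := hA a b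
    have : 0 < B t a b := add_pos_of_nonneg_of_pos (mul_nonneg h5.le h7) (mul_pos h4 h6)
    exact this.ne'

/-- The channel obtained from a joint law `J` with first marginal `P` by conditioning, completed
by `V` on the rows where `P` vanishes. -/
noncomputable def chanOf {κ α : Type} (P : κ → ℝ) (V J : κ → α → ℝ) (a : κ) (b : α) : ℝ :=
  if P a = 0 then V a b else J a b / P a

lemma eq_zero_of_marginal_eq_zero {κ α : Type} [Fintype α] {P : κ → ℝ} {J : κ → α → ℝ}
    (hJ : ∀ a b, 0 ≤ J a b) (hJX : ∀ a, ∑ b, J a b = P a) {a : κ} (h : P a = 0) (b : α) :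
    J a b = 0 :=
  (Finset.sum_eq_zero_iff_of_nonneg fun b _ => hJ a b).1 ((hJX a).trans h) b (Finset.mem_univ b)

lemma ne_zero_of_joint_ne_zero {κ α : Type} [Fintype α] {P : κ → ℝ} {J : κ → α → ℝ}
    (hJ : ∀ a b, 0 ≤ J a b) (hJX : ∀ a, ∑ b, J a b = P a) {a : κ} {b : α} (h : J a b ≠ 0) :
    P a ≠ 0 :=
  fun h0 => h (eq_zero_of_marginal_eq_zero hJ hJX h0 b)

lemma mul_chanOf {κ α : Type} [Fintype α] {P : κ → ℝ} {V J : κ → α → ℝ}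
    (hJ : ∀ a b, 0 ≤ J a b) (hJX : ∀ a, ∑ b, J a b = P a) (a : κ) (b : α) :
    P a * chanOf P V J a b = J a b := by
  unfold chanOf
  split_ifs with h
  · rw [h, zero_mul, eq_zero_of_marginal_eq_zero hJ hJX h b]
  · field_simp

lemma isChannel_chanOf {κ α : Type} [Fintype κ] [Fintype α] {P : κ → ℝ} {V J : κ → α → ℝ}
    (hP : ∀ a, 0 ≤ P a) (hV : IsChannel V) (hJ : ∀ a b, 0 ≤ J a b)
    (hJX : ∀ a, ∑ b, J a b = P a) : IsChannel (chanOf P V J) := by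
  intro a
  by_cases h : P a = 0
  · simpa [chanOf, h, IsPMF] using hV a
  · refine ⟨fun b => ?_, ?_⟩
    · simp only [chanOf, h, if_false]
      exact div_nonneg (hJ a b) (hP a)
    · simp only [chanOf, h, if_false]
      rw [← Finset.sum_div, hJX, div_self h]

/-- Divergence `D(J ‖ P · W)` of joint laws. -/
noncomputable def divJ {κ α : Type} [Fintype κ] [Fintype α] (P : κ → ℝ) (W J : κ → α → ℝ) : ℝ :=
  ∑ a, ∑ b, J a b * Real.log (J a b / (P a * W a b))

/-- Mutual information of a joint law `J` with first marginal `P`. -/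
noncomputable def infoJ {κ α : Type} [Fintype κ] [Fintype α] (P : κ → ℝ) (J : κ → α → ℝ) : ℝ :=
  ∑ a, ∑ b, J a b * Real.log (J a b / (P a * ∑ a', J a' b))

/-- Expected negative log-likelihood of `W` under a joint law `J`. -/
noncomputable def costJ {κ α : Type} [Fintype κ] [Fintype α] (W J : κ → α → ℝ) : ℝ :=
  -∑ a, ∑ b, J a b * Real.log (W a b)

lemma divJ_nonneg {κ α : Type} [Fintype κ] [Fintype α] {P : κ → ℝ} {W J : κ → α → ℝ}
    (hP : IsPMF P) (hW : IsChannel W) (hJ : ∀ a b, 0 ≤ J a b) (hJX : ∀ a, ∑ b, J a b = P a)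
    (hJW : ∀ a b, J a b ≠ 0 → W a b ≠ 0) : 0 ≤ divJ P W J := by
  have h0 : ∑ a, ∑ b, (J a b - P a * W a b) = 0 := by
    simp only [Finset.sum_sub_distrib, ← Finset.mul_sum, hJX, (hW _).2]
    simp
  rw [← h0]
  refine Finset.sum_le_sum fun a _ => Finset.sum_le_sum fun b _ => ?_
  by_cases h : J a b = 0
  · simp only [h, zero_sub, zero_mul, Left.neg_nonpos_iff]
    exact mul_nonneg (hP.1 a) ((hW a).1 b)
  · have hJ0 : 0 < J a b := lt_of_le_of_ne (hJ a b) (Ne.symm h)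
    have hP0 : 0 < P a := lt_of_le_of_ne (hP.1 a) (Ne.symm (ne_zero_of_joint_ne_zero hJ hJX h))
    have hW0 : 0 < W a b := lt_of_le_of_ne ((hW a).1 b) (Ne.symm (hJW a b h))
    have h1 := Real.one_sub_inv_le_log_of_pos (div_pos hJ0 (mul_pos hP0 hW0))
    have h2 := mul_le_mul_of_nonneg_left h1 hJ0.le
    calc J a b - P a * W a b = J a b * (1 - (J a b / (P a * W a b))⁻¹) := by field_simp
      _ ≤ _ := h2

lemma condKL_eq_divJ {κ α : Type} [Fintype κ] [Fintype α] {P : κ → ℝ} {W Q J : κ → α → ℝ}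
    (hPQ : ∀ a b, P a * Q a b = J a b) (hJW : ∀ a b, J a b ≠ 0 → W a b ≠ 0) :
    condKL P Q W = ENNReal.ofReal (divJ P W J) := by
  unfold condKL
  rw [if_pos fun a b h => hJW a b (hPQ a b ▸ h)]
  congr 1
  refine Finset.sum_congr rfl fun a _ => Finset.sum_congr rfl fun b _ => ?_
  rw [hPQ]
  by_cases h : J a b = 0
  · simp [h]
  · rw [← hPQ a b, mul_div_mul_left _ _ (left_ne_zero_of_mul (hPQ a b ▸ h))]

lemma mutualInfo_eq_infoJ {κ α : Type} [Fintype κ] [Fintype α] {P : κ → ℝ} {Q J : κ → α → ℝ}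
    (hPQ : ∀ a b, P a * Q a b = J a b) : mutualInfo P Q = infoJ P J := by
  refine Finset.sum_congr rfl fun a _ => Finset.sum_congr rfl fun b _ => ?_
  simp only [hPQ]
  by_cases h : J a b = 0
  · simp [h]
  · rw [← hPQ a b, mul_div_mul_left _ _ (left_ne_zero_of_mul (hPQ a b ▸ h))]

lemma condH_nonneg {κ α : Type} [Fintype κ] [Fintype α] {P : κ → ℝ} {Q : κ → α → ℝ}
    (hP : IsPMF P) (hQ : IsChannel Q) : 0 ≤ condH P Q := by
  unfold condH
  rw [neg_nonneg]
  refine Finset.sum_nonpos fun a _ => Finset.sum_nonpos fun b _ => ?_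
  exact mul_nonpos_of_nonneg_of_nonpos (mul_nonneg (hP.1 a) ((hQ a).1 b))
    (Real.log_nonpos ((hQ a).1 b) ((hQ a).le_one b))

lemma condKL_add_condH {κ α : Type} [Fintype κ] [Fintype α] {P : κ → ℝ} {W Q J : κ → α → ℝ}
    (hP : IsPMF P) (hW : IsChannel W) (hQ : IsChannel Q)
    (hPQ : ∀ a b, P a * Q a b = J a b) (hJW : ∀ a b, J a b ≠ 0 → W a b ≠ 0) :
    condKL P Q W + ENNReal.ofReal (condH P Q) = ENNReal.ofReal (costJ W J) := by
  have hJ : ∀ a b, 0 ≤ J a b := fun a b => hPQ a b ▸ mul_nonneg (hP.1 a) ((hQ a).1 b)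
  have hJX : ∀ a, ∑ b, J a b = P a := fun a => by
    simp only [← hPQ, ← Finset.mul_sum, (hQ a).2, mul_one]
  rw [condKL_eq_divJ hPQ hJW, ← ENNReal.ofReal_add (divJ_nonneg hP hW hJ hJX hJW)
    (condH_nonneg hP hQ)]
  congr 1
  unfold divJ condH costJ
  rw [← sub_eq_add_neg, ← Finset.sum_sub_distrib, ← Finset.sum_neg_distrib]
  refine Finset.sum_congr rfl fun a _ => ?_
  rw [← Finset.sum_sub_distrib, ← Finset.sum_neg_distrib]
  refine Finset.sum_congr rfl fun b _ => ?_
  rw [hPQ]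
  by_cases h : J a b = 0
  · simp [h]
  · have h1 : P a * Q a b ≠ 0 := hPQ a b ▸ h
    have h2 := left_ne_zero_of_mul h1
    have h3 := right_ne_zero_of_mul h1
    rw [← hPQ a b, mul_div_mul_left _ _ h2, Real.log_div h3 (hJW a b h)]
    ring

/-- What the joint exponent says about a pair of joint types that the detector may confuse. -/
lemma exists_better_or_le_of_le_rhoJoint [Fintype 𝒳] [Fintype 𝒴] {W : 𝒮 → 𝒳 → 𝒴 → ℝ}
    (hW : ∀ s, IsChannel (W s)) {P : 𝒳 → ℝ} (hP : IsPMF P) {R E : ℝ} (hR : 0 ≤ R)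
    (hE : ENNReal.ofReal E ≤ rhoJoint W P R) {s s' : 𝒮} (hs : s' ≠ s) {J K : 𝒳 → 𝒴 → ℝ}
    (hJ : ∀ a b, 0 ≤ J a b) (hK : ∀ a b, 0 ≤ K a b)
    (hJX : ∀ a, ∑ b, J a b = P a) (hKX : ∀ a, ∑ b, K a b = P a)
    (hY : ∀ b, ∑ a, K a b = ∑ a, J a b)
    (hJW : ∀ a b, J a b ≠ 0 → W s a b ≠ 0) (hKW : ∀ a b, K a b ≠ 0 → W s' a b ≠ 0)
    (hc : costJ (W s') K ≤ costJ (W s) J) (hD : divJ P (W s) J < E) :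
    (∃ A : 𝒳 → 𝒴 → ℝ, (∀ a b, 0 ≤ A a b) ∧ (∀ a, ∑ b, A a b = P a) ∧
      (∀ b, ∑ a, A a b = ∑ a, J a b) ∧ (∀ a b, A a b ≠ 0 → W s a b ≠ 0) ∧
      ∑ a, ∑ b, A a b * Real.log (A a b / (P a * ∑ a', J a' b)) < R ∧
      costJ (W s) A < costJ (W s') K) ∨
    E ≤ divJ P (W s) J + (infoJ P K - R) := by
  set Q := chanOf P (W s) J with hQdef
  set Q' := chanOf P (W s') K with hQ'def
  have hQ : IsChannel Q := isChannel_chanOf hP.1 (hW s) hJ hJX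
  have hQ' : IsChannel Q' := isChannel_chanOf hP.1 (hW s') hK hKX
  have hPQ : ∀ a b, P a * Q a b = J a b := mul_chanOf hJ hJX
  have hPQ' : ∀ a b, P a * Q' a b = K a b := mul_chanOf hK hKX
  have hD0 := divJ_nonneg hP (hW s) hJ hJX hJW
  by_cases hb : beta W Q P R s < ENNReal.ofReal (costJ (W s') K)
  · left
    unfold beta at hb
    simp only [iInf_lt_iff] at hb
    obtain ⟨Q'', ⟨hc'', hI'', hY''⟩, hlt⟩ := hb
    have hsup : ∀ a b, P a * Q'' a b ≠ 0 → W s a b ≠ 0 := by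
      by_contra hcon
      unfold condKL at hlt
      rw [if_neg hcon, top_add] at hlt
      exact not_top_lt hlt
    refine ⟨fun a b => P a * Q'' a b, fun a b => mul_nonneg (hP.1 a) ((hc'' a).1 b), fun a => ?_,
      fun b => ?_, hsup, ?_, ?_⟩
    · rw [← Finset.mul_sum, (hc'' a).2, mul_one]
    · simpa only [outDist, hPQ] using hY'' b
    · have h1 := hI''
      rw [mutualInfo_eq_infoJ fun _ _ => rfl] at h1
      have h2 : ∀ b, ∑ a, J a b = ∑ a, P a * Q'' a b := fun b => by
        simpa only [outDist, hPQ] using (hY'' b).symm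
      simpa only [infoJ, h2] using h1
    · rw [condKL_add_condH hP (hW s) hc'' (fun _ _ => rfl) hsup] at hlt
      exact (ENNReal.ofReal_lt_ofReal_iff'.1 hlt).1
  · right
    have hmem : Q' ∈ PSet W Q P R s s' := by
      refine ⟨hQ', ?_, fun b => ?_⟩
      · rw [condKL_add_condH hP (hW s') hQ' hPQ' hKW, condKL_add_condH hP (hW s) hQ hPQ hJW]
        exact le_min (not_lt.1 hb) (ENNReal.ofReal_le_ofReal hc)
      · simpa only [outDist, hPQ, hPQ'] using hY b
    have h1 : ENNReal.ofReal E ≤ ENNReal.ofReal (divJ P (W s) J)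
        + (ENNReal.ofReal (infoJ P K) - ENNReal.ofReal R) := by
      refine hE.trans ?_
      unfold rhoJoint
      refine (iInf_le _ s).trans ((iInf₂_le Q hQ).trans ?_)
      rw [condKL_eq_divJ hPQ hJW]
      gcongr
      rw [← mutualInfo_eq_infoJ hPQ']
      exact (iInf₂_le s' hs).trans (iInf₂_le Q' hmem)
    rw [← ENNReal.ofReal_sub _ hR] at h1
    by_cases h2 : infoJ P K - R ≤ 0
    · rw [ENNReal.ofReal_of_nonpos h2, add_zero, ENNReal.ofReal_le_ofReal_iff hD0] at h1
      exact absurd h1 (not_le.2 hD)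
    · rw [← ENNReal.ofReal_add hD0 (not_le.1 h2).le,
        ENNReal.ofReal_le_ofReal_iff (add_nonneg hD0 (not_le.1 h2).le)] at h1
      exact h1

/-- Output sequences whose joint type with the input is close to an atypical `J` have
exponentially small probability. -/
lemma exists_nhds_sum_emp_mem_le {κ α : Type} [Fintype κ] [Fintype α] {P : κ → ℝ} (hP : IsPMF P)
    {V J : κ → α → ℝ} (hV : IsChannel V) (hJ : ∀ a b, 0 ≤ J a b) (hJX : ∀ a, ∑ b, J a b = P a)
    (hJV : ∀ a b, J a b ≠ 0 → V a b ≠ 0) {c : ℝ} (hc : c < divJ P V J) :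
    ∃ U ∈ nhds J, ∀ (n : ℕ) (x : Fin n → κ),
      ∑ y : Fin n → α, ind (emp x y ∈ U) * seqP V x y ≤ Real.exp (-(n * c)) := by
  refine tilt_local hV (isChannel_chanOf (V := V) hP.1 hV hJ hJX) hJ (fun a b h => ⟨hJV a b h, ?_⟩)
    (by simp only [hJX, hP.2]) (hc.trans_eq ?_)
  · intro h0
    exact h (by rw [← mul_chanOf (V := V) hJ hJX, h0, mul_zero])
  · refine Finset.sum_congr rfl fun a _ => Finset.sum_congr rfl fun b _ => ?_
    by_cases h : J a b = 0
    · simp [h]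
    · rw [chanOf, if_neg (ne_zero_of_joint_ne_zero hJ hJX h), div_div]

/-- Independent codewords are jointly typical with a given output with exponentially small
probability, the exponent being the mutual information. -/
lemma exists_nhds_sum_powP_emp_mem_le {κ α : Type} [Fintype κ] [Fintype α] {P : κ → ℝ}
    (hP : IsPMF P) {K : κ → α → ℝ} (hK : ∀ a b, 0 ≤ K a b) (hKX : ∀ a, ∑ b, K a b = P a)
    {c : ℝ} (hc : c < infoJ P K) :
    ∃ U ∈ nhds K, ∀ (n : ℕ) (y : Fin n → α),
      ∑ x : Fin n → κ, powP P x * ind (emp x y ∈ U) ≤ Real.exp (-(n * c)) := by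
  set T : α → κ → ℝ := fun b a => K a b with hT
  set q : α → ℝ := fun b => ∑ a, K a b with hq
  have hq0 : ∀ b, 0 ≤ q b := fun b => Finset.sum_nonneg fun a _ => hK a b
  have hT0 : ∀ b a, 0 ≤ T b a := fun b a => hK a b
  have hTX : ∀ b, ∑ a, T b a = q b := fun b => rfl
  have hq1 : IsPMF q := ⟨hq0, by rw [hq, Finset.sum_comm]; simp only [hKX, hP.2]⟩
  have hV : IsChannel (fun _ : α => P) := fun _ => hP
  obtain ⟨U, hU, h⟩ := exists_nhds_sum_emp_mem_le (V := fun _ : α => P) (c := c) hq1 hV hT0 hTX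
    (fun b a h0 => ne_zero_of_joint_ne_zero hK hKX h0) (by
      refine hc.trans_eq ?_
      unfold infoJ divJ
      rw [Finset.sum_comm]
      refine Finset.sum_congr rfl fun b _ => Finset.sum_congr rfl fun a _ => ?_
      rw [mul_comm (P a)])
  refine ⟨(fun K' : κ → α → ℝ => fun b a => K' a b) ⁻¹' U, ?_, fun n y => ?_⟩
  · have hcont : Continuous (fun K' : κ → α → ℝ => fun b a => K' a b) := by fun_prop
    exact hcont.continuousAt.preimage_mem_nhds hU
  · refine le_trans (le_of_eq ?_) (h n y)
    refine Finset.sum_congr rfl fun x _ => ?_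
    have e : (emp x y ∈ (fun K' : κ → α → ℝ => fun b a => K' a b) ⁻¹' U) = (emp y x ∈ U) := by
      rw [Set.mem_preimage]
      congr 1
      funext b a
      exact emp_swap x y a b
    rw [e, mul_comm]
    rfl

/-- Another codeword, in state law `V'`, explains the output at least as well as every typical
codeword does in the true state law `V`, and the pair of joint types lies in `U`. -/
def Confused {n M : ℕ} (P : 𝒳 → ℝ) (δ : ℝ) (V V' : 𝒳 → 𝒴 → ℝ)
    (U : Set ((𝒳 → 𝒴 → ℝ) × (𝒳 → 𝒴 → ℝ))) (C : Fin M → Fin n → 𝒳) (w : Fin M)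
    (y : Fin n → 𝒴) : Prop :=
  ∃ w', w' ≠ w ∧ Typ P (2 * δ) (C w') ∧ (emp (C w) y, emp (C w') y) ∈ U ∧
    ∀ v, Typ P (2 * δ) (C v) → seqP V (C v) y ≤ seqP V' (C w') y

/-- Ensemble average of the probability that message `w` has a typical codeword and is
confused. -/
noncomputable def confLoss [Fintype 𝒳] [Fintype 𝒴] (n : ℕ) {M : ℕ} (P : 𝒳 → ℝ) (δ : ℝ)
    (V V' : 𝒳 → 𝒴 → ℝ) (U : Set ((𝒳 → 𝒴 → ℝ) × (𝒳 → 𝒴 → ℝ))) (w : Fin M) : ℝ :=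
  EC (powP P) fun C : Fin M → Fin n → 𝒳 =>
    ind (Typ P δ (C w)) * ∑ y, ind (Confused P δ V V' U C w y) * seqP V (C w) y

/-- Near the pair `(J, K)` of joint types, confusion has exponent at least `c`. -/
def LocalBound [Fintype 𝒳] [Fintype 𝒴] (P : 𝒳 → ℝ) (V V' : 𝒳 → 𝒴 → ℝ) (R c : ℝ)
    (J K : 𝒳 → 𝒴 → ℝ) : Prop :=
  ∃ U ∈ nhds (J, K), ∀ᶠ δ in nhdsWithin (0 : ℝ) (Set.Ioi 0), ∀ᶠ n : ℕ in Filter.atTop,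
    ∀ M : ℕ, Real.exp (n * (R - δ)) ≤ M → (M : ℝ) ≤ Real.exp (n * (R - δ)) + 1 →
      ∀ w : Fin M, confLoss n P δ V V' U w ≤ Real.exp (-(n * c))

lemma localBound_of_eq_zero [Fintype 𝒳] [Fintype 𝒴] {P : 𝒳 → ℝ} (hP : IsPMF P)
    {V V' : 𝒳 → 𝒴 → ℝ} {J K : 𝒳 → 𝒴 → ℝ} {U : Set ((𝒳 → 𝒴 → ℝ) × (𝒳 → 𝒴 → ℝ))}
    (hU : U ∈ nhds (J, K))
    (h : ∀ᶠ δ in nhdsWithin (0 : ℝ) (Set.Ioi 0), ∀ n > 0, ∀ (x x' : Fin n → 𝒳) (y : Fin n → 𝒴),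
      Typ P δ x → Typ P (2 * δ) x' → (emp x y, emp x' y) ∈ U → seqP V x y ≤ seqP V' x' y →
        seqP V x y = 0) (R c : ℝ) :
    LocalBound P V V' R c J K := by
  refine ⟨U, hU, ?_⟩
  filter_upwards [h, self_mem_nhdsWithin] with δ hδ hδ0
  filter_upwards [Filter.eventually_gt_atTop 0] with n hn M _ _ w
  have hδ0 : 0 < δ := hδ0
  refine le_trans ?_ (Real.exp_pos _).le
  refine (EC_mono (powP_nonneg hP.1) (G := fun _ => 0) fun C _ => le_of_eq ?_).trans_eq
    (EC_const (isPMF_powP hP n) 0)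
  by_cases ht : Typ P δ (C w)
  · rw [Finset.sum_eq_zero fun y _ => ?_, mul_zero]
    by_cases hc : Confused P δ V V' U C w y
    · obtain ⟨w', hw', ht', hm, hv⟩ := hc
      rw [hδ n hn (C w) (C w') y ht ht' hm (hv w fun a => (ht a).trans (by linarith)), mul_zero]
    · rw [ind_not hc, zero_mul]
  · rw [ind_not ht, zero_mul]

lemma seqP_eq_zero_of_emp_pos {κ α : Type} {n : ℕ} {V : κ → α → ℝ} {x : Fin n → κ}
    {y : Fin n → α} {a : κ} {b : α} (h : 0 < emp x y a b) (hV : V a b = 0) : seqP V x y = 0 := by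
  obtain ⟨i, rfl, rfl⟩ := exists_of_emp_pos h
  exact Finset.prod_eq_zero (Finset.mem_univ i) hV

lemma seqP_eq_exp_costJ {κ α : Type} [Fintype κ] [Fintype α] {n : ℕ} {V : κ → α → ℝ}
    (hV : ∀ a b, 0 ≤ V a b) {x : Fin n → κ} {y : Fin n → α} (h : seqP V x y ≠ 0) :
    seqP V x y = Real.exp (-(n * costJ V (emp x y))) := by
  rw [seqP_eq_exp (pos_of_seqP_ne_zero hV h), costJ, mul_neg, neg_neg]

lemma continuous_costJ {κ α : Type} [Fintype κ] [Fintype α] (V : κ → α → ℝ) :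
    Continuous (costJ V) :=
  (continuous_sum_mul _).neg

section
variable [Fintype 𝒳] [Fintype 𝒴] {P : 𝒳 → ℝ} {V V' : 𝒳 → 𝒴 → ℝ} {J K : 𝒳 → 𝒴 → ℝ}

lemma localBound_of_marginal_left_ne (hP : IsPMF P) {a : 𝒳} (h : ∑ b, J a b ≠ P a) (R c : ℝ) :
    LocalBound P V V' R c J K := by
  have hpos : 0 < |∑ b, J a b - P a| := abs_pos.2 (sub_ne_zero.2 h)
  have hcont : Continuous fun p : (𝒳 → 𝒴 → ℝ) × (𝒳 → 𝒴 → ℝ) => |∑ b, p.1 a b - P a| := by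
    fun_prop
  refine localBound_of_eq_zero hP
    (hcont.continuousAt.eventually (lt_mem_nhds (half_lt_self hpos))) ?_ R c
  filter_upwards [nhdsWithin_le_nhds (gt_mem_nhds (half_pos hpos))] with δ hδ n _ x x' y hx _ hm
  have hm : |∑ b, J a b - P a| / 2 < |∑ b, emp x y a b - P a| := hm
  rw [sum_emp_right] at hm
  exact absurd (hx a) (not_le.2 (hδ.trans hm))

lemma localBound_of_marginal_right_ne (hP : IsPMF P) {a : 𝒳} (h : ∑ b, K a b ≠ P a) (R c : ℝ) :
    LocalBound P V V' R c J K := by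
  have hpos : 0 < |∑ b, K a b - P a| := abs_pos.2 (sub_ne_zero.2 h)
  have hcont : Continuous fun p : (𝒳 → 𝒴 → ℝ) × (𝒳 → 𝒴 → ℝ) => |∑ b, p.2 a b - P a| := by
    fun_prop
  refine localBound_of_eq_zero hP
    (hcont.continuousAt.eventually (lt_mem_nhds (half_lt_self hpos))) ?_ R c
  filter_upwards [nhdsWithin_le_nhds (gt_mem_nhds (half_pos (half_pos hpos)))]
    with δ hδ n _ x x' y _ hx' hm
  have hm : |∑ b, K a b - P a| / 2 < |∑ b, emp x' y a b - P a| := hm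
  rw [sum_emp_right] at hm
  exact absurd (hx' a) (not_le.2 (by linarith))

lemma localBound_of_output_ne (hP : IsPMF P) {b : 𝒴} (h : ∑ a, K a b ≠ ∑ a, J a b) (R c : ℝ) :
    LocalBound P V V' R c J K := by
  have hcont : Continuous fun p : (𝒳 → 𝒴 → ℝ) × (𝒳 → 𝒴 → ℝ) =>
      ∑ a, p.2 a b - ∑ a, p.1 a b := by fun_prop
  refine localBound_of_eq_zero hP
    (hcont.continuousAt.eventually (isOpen_ne.mem_nhds (sub_ne_zero.2 h))) ?_ R c
  refine Filter.Eventually.of_forall fun δ n _ x x' y _ _ hm => absurd ?_ hm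
  simp only [emp_swap _ y _ b, sum_emp_right, sub_self]

lemma localBound_of_left_zero (hP : IsPMF P) {a : 𝒳} {b : 𝒴} (hJ : 0 < J a b) (hV : V a b = 0)
    (R c : ℝ) : LocalBound P V V' R c J K := by
  have hcont : Continuous fun p : (𝒳 → 𝒴 → ℝ) × (𝒳 → 𝒴 → ℝ) => p.1 a b := by fun_prop
  refine localBound_of_eq_zero hP (hcont.continuousAt.eventually (lt_mem_nhds hJ)) ?_ R c
  exact Filter.Eventually.of_forall fun δ n _ x x' y _ _ hm _ => seqP_eq_zero_of_emp_pos hm hV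

lemma localBound_of_right_zero (hP : IsPMF P) (hV0 : ∀ a b, 0 ≤ V a b) {a : 𝒳} {b : 𝒴}
    (hK : 0 < K a b) (hV' : V' a b = 0) (R c : ℝ) : LocalBound P V V' R c J K := by
  have hcont : Continuous fun p : (𝒳 → 𝒴 → ℝ) × (𝒳 → 𝒴 → ℝ) => p.2 a b := by fun_prop
  refine localBound_of_eq_zero hP (hcont.continuousAt.eventually (lt_mem_nhds hK)) ?_ R c
  refine Filter.Eventually.of_forall fun δ n _ x x' y _ _ hm hle => ?_
  rw [seqP_eq_zero_of_emp_pos (V := V') hm hV'] at hle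
  exact le_antisymm hle (seqP_nonneg hV0 x y)

lemma localBound_of_costJ_lt (hP : IsPMF P) (hV0 : ∀ a b, 0 ≤ V a b) (hV0' : ∀ a b, 0 ≤ V' a b)
    (h : costJ V J < costJ V' K) (R c : ℝ) : LocalBound P V V' R c J K := by
  have hcont : Continuous fun p : (𝒳 → 𝒴 → ℝ) × (𝒳 → 𝒴 → ℝ) => costJ V' p.2 - costJ V p.1 :=
    ((continuous_costJ V').comp continuous_snd).sub ((continuous_costJ V).comp continuous_fst)
  refine localBound_of_eq_zero hP
    (hcont.continuousAt.eventually (lt_mem_nhds (sub_pos.2 h))) ?_ R c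
  refine Filter.Eventually.of_forall fun δ n hn x x' y _ _ hm hle => ?_
  have hm : 0 < costJ V' (emp x' y) - costJ V (emp x y) := hm
  by_contra h0
  have h1 : 0 < seqP V x y := lt_of_le_of_ne (seqP_nonneg hV0 x y) (Ne.symm h0)
  have h2 := (h1.trans_le hle).ne'
  rw [seqP_eq_exp_costJ hV0 h0, seqP_eq_exp_costJ hV0' h2, Real.exp_le_exp,
    neg_le_neg_iff, mul_le_mul_iff_right₀ (by exact_mod_cast hn)] at hle
  linarith

lemma localBound_of_lt_divJ (hP : IsPMF P) (hV : IsChannel V) (hJ : ∀ a b, 0 ≤ J a b)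
    (hJX : ∀ a, ∑ b, J a b = P a) (hJV : ∀ a b, J a b ≠ 0 → V a b ≠ 0) {c : ℝ}
    (hc : c < divJ P V J) (R : ℝ) : LocalBound P V V' R c J K := by
  obtain ⟨U, hU, h⟩ := exists_nhds_sum_emp_mem_le hP hV hJ hJX hJV hc
  refine ⟨Prod.fst ⁻¹' U, continuous_fst.continuousAt.preimage_mem_nhds hU,
    Filter.Eventually.of_forall fun δ => Filter.Eventually.of_forall fun n M _ _ w => ?_⟩
  refine (EC_mono (powP_nonneg hP.1) (G := fun _ => Real.exp (-(n * c))) fun C _ => ?_).trans_eq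
    (EC_const (isPMF_powP hP n) _)
  refine le_trans ?_ (h n (C w))
  refine (mul_le_of_le_one_left (Finset.sum_nonneg fun y _ =>
    mul_nonneg (ind_nonneg _) (seqP_nonneg (fun k => (hV k).1) _ _)) (ind_le_one _)).trans ?_
  refine Finset.sum_le_sum fun y _ => mul_le_mul_of_nonneg_right (ind_mono ?_)
    (seqP_nonneg (fun k => (hV k).1) _ _)
  rintro ⟨w', -, -, hm, -⟩
  exact hm

lemma localBound_of_lt_divJ_add_infoJ (hP : IsPMF P) (hV : IsChannel V)
    (hJ : ∀ a b, 0 ≤ J a b) (hK : ∀ a b, 0 ≤ K a b)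
    (hJX : ∀ a, ∑ b, J a b = P a) (hKX : ∀ a, ∑ b, K a b = P a)
    (hJV : ∀ a b, J a b ≠ 0 → V a b ≠ 0) {R c : ℝ}
    (hc : c < divJ P V J + (infoJ P K - R)) : LocalBound P V V' R c J K := by
  set η := (divJ P V J + (infoJ P K - R) - c) / 2 with hη
  have hη0 : 0 < η := by linarith
  obtain ⟨U, hU, h⟩ := exists_nhds_sum_emp_mem_le (c := divJ P V J - η) hP hV hJ hJX hJV
    (by linarith)
  obtain ⟨U', hU', h'⟩ := exists_nhds_sum_powP_emp_mem_le (c := infoJ P K - η) hP hK hKX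
    (by linarith)
  have hV0 : ∀ a b, 0 ≤ V a b := fun k => (hV k).1
  refine ⟨U ×ˢ U', prod_mem_nhds hU hU', ?_⟩
  filter_upwards [self_mem_nhdsWithin] with δ hδ
  have hδ : 0 < δ := hδ
  refine Filter.Eventually.of_forall fun n M _ hM w => ?_
  calc confLoss n P δ V V' (U ×ˢ U') w
      ≤ EC (powP P) fun C : Fin M → Fin n → 𝒳 => ∑ w' ∈ Finset.univ.erase w,
          ∑ y, ind (emp (C w) y ∈ U) * ind (emp (C w') y ∈ U') * seqP V (C w) y := by
        refine EC_mono (powP_nonneg hP.1) fun C _ => ?_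
        refine (mul_le_of_le_one_left (Finset.sum_nonneg fun y _ =>
          mul_nonneg (ind_nonneg _) (seqP_nonneg hV0 _ _)) (ind_le_one _)).trans ?_
        rw [Finset.sum_comm]
        refine Finset.sum_le_sum fun y _ => ?_
        rw [← Finset.sum_mul]
        refine mul_le_mul_of_nonneg_right ?_ (seqP_nonneg hV0 _ _)
        simp only [← ind_and]
        refine le_trans (ind_mono ?_) (ind_exists_mem_le (Finset.univ.erase w) _)
        rintro ⟨w', hw', -, hm, -⟩
        exact ⟨w', Finset.mem_erase.2 ⟨hw', Finset.mem_univ _⟩, hm⟩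
    _ = ∑ w' ∈ Finset.univ.erase w, ∑ x : Fin n → 𝒳, powP P x * ∑ x' : Fin n → 𝒳, powP P x' *
          ∑ y, ind (emp x y ∈ U) * ind (emp x' y ∈ U') * seqP V x y := by
        rw [EC_sum]
        refine Finset.sum_congr rfl fun w' hw' => ?_
        exact EC_pair (isPMF_powP hP n) (Finset.ne_of_mem_erase hw')
          fun x x' => ∑ y, ind (emp x y ∈ U) * ind (emp x' y ∈ U') * seqP V x y
    _ ≤ ∑ w' ∈ Finset.univ.erase w,
          Real.exp (-(n * (divJ P V J - η))) * Real.exp (-(n * (infoJ P K - η))) := by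
        refine Finset.sum_le_sum fun w' _ => ?_
        refine (Finset.sum_le_sum fun x _ => mul_le_mul_of_nonneg_left (?_ : _ ≤
          Real.exp (-(n * (divJ P V J - η))) * Real.exp (-(n * (infoJ P K - η))))
          (powP_nonneg hP.1 x)).trans_eq ?_
        · calc ∑ x' : Fin n → 𝒳, powP P x' *
                ∑ y, ind (emp x y ∈ U) * ind (emp x' y ∈ U') * seqP V x y
              = ∑ y, ind (emp x y ∈ U) * seqP V x y *
                  ∑ x' : Fin n → 𝒳, powP P x' * ind (emp x' y ∈ U') := by
                simp only [Finset.mul_sum]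
                rw [Finset.sum_comm]
                exact Finset.sum_congr rfl fun y _ => Finset.sum_congr rfl fun x' _ => by ring
            _ ≤ ∑ y, ind (emp x y ∈ U) * seqP V x y * Real.exp (-(n * (infoJ P K - η))) :=
                Finset.sum_le_sum fun y _ => mul_le_mul_of_nonneg_left (h' n y)
                  (mul_nonneg (ind_nonneg _) (seqP_nonneg hV0 _ _))
            _ ≤ _ := by
                rw [← Finset.sum_mul]
                exact mul_le_mul_of_nonneg_right (h n x) (Real.exp_pos _).le
        · rw [← Finset.sum_mul, (isPMF_powP hP n).2, one_mul]
    _ ≤ Real.exp (n * R) *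
          (Real.exp (-(n * (divJ P V J - η))) * Real.exp (-(n * (infoJ P K - η)))) := by
        rw [Finset.sum_const, nsmul_eq_mul]
        refine mul_le_mul_of_nonneg_right ?_ (by positivity)
        rw [Finset.card_erase_of_mem (Finset.mem_univ _), Finset.card_univ, Fintype.card_fin,
          Nat.cast_sub (Nat.one_le_iff_ne_zero.2 (Fin.pos w).ne'), Nat.cast_one]
        have : Real.exp (n * (R - δ)) ≤ Real.exp (n * R) :=
          Real.exp_le_exp.2 (mul_le_mul_of_nonneg_left (by linarith) (Nat.cast_nonneg n))
        linarith
    _ = Real.exp (-(n * c)) := by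
        rw [← Real.exp_add, ← Real.exp_add]
        congr 1
        rw [hη]
        ring

end

lemma eventually_mul_le_exp_sub_one {ρ : ℝ} (hρ : 0 < ρ) (c : ℝ) :
    ∀ᶠ n : ℕ in Filter.atTop, n * c ≤ Real.exp (n * ρ) - 1 := by
  obtain ⟨N, hN⟩ := exists_nat_ge (2 * c / ρ ^ 2)
  filter_upwards [Filter.eventually_ge_atTop N] with n hn
  have h1 := Real.quadratic_le_exp_of_nonneg (x := n * ρ) (by positivity)
  have h2 : 2 * c / ρ ^ 2 ≤ n := hN.trans (by exact_mod_cast hn)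
  rw [div_le_iff₀ (by positivity)] at h2
  have h3 : n * (2 * c) ≤ n * (n * ρ ^ 2) := mul_le_mul_of_nonneg_left h2 (Nat.cast_nonneg n)
  have h4 : 0 ≤ n * ρ := by positivity
  nlinarith

/-- If each of the other random codewords is, with probability at least `q`, preferred to the
confusing codeword, then confusion has probability at most `(1 - q) ^ (M - 1)`. -/
lemma sum_EC_prod_not_le [Fintype 𝒳] [Fintype 𝒴] {P : 𝒳 → ℝ} (hP : IsPMF P)
    {V : 𝒳 → 𝒴 → ℝ} (hV : IsChannel V) {n M : ℕ} (w : Fin M) (B : (Fin n → 𝒳) → (Fin n → 𝒴) → Prop)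
    (G : (Fin n → 𝒳) → (Fin n → 𝒴) → Prop) {q : ℝ}
    (h : ∀ x y, B x y → seqP V x y ≠ 0 → powP P x ≠ 0 → q ≤ ∑ x', powP P x' * ind (G x' y)) :
    EC (powP P) (fun C : Fin M → Fin n → 𝒳 => ∑ y, ind (B (C w) y) * seqP V (C w) y *
      ∏ v ∈ Finset.univ.erase w, ind (¬ G (C v) y)) ≤ Real.exp (-(q * ((M : ℝ) - 1))) := by
  have hV0 : ∀ a b, 0 ≤ V a b := fun k => (hV k).1
  have hp := isPMF_powP hP n
  rw [EC_sum]
  have e : ∀ y : Fin n → 𝒴, EC (powP P) (fun C : Fin M → Fin n → 𝒳 =>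
      ind (B (C w) y) * seqP V (C w) y * ∏ v ∈ Finset.univ.erase w, ind (¬ G (C v) y))
      = ∑ x, powP P x * (ind (B x y) * seqP V x y *
        ∏ v ∈ (Finset.univ : Finset (Fin M)).erase w, ∑ x', powP P x' * ind (¬ G x' y)) := fun y =>
    EC_prod (powP P) w (fun x => ind (B x y) * seqP V x y) fun _ _ x' => ind (¬ G x' y)
  simp only [e]
  calc _ ≤ ∑ y : Fin n → 𝒴, ∑ x : Fin n → 𝒳,
        powP P x * (seqP V x y * Real.exp (-(q * ((M : ℝ) - 1)))) := by
        refine Finset.sum_le_sum fun y _ => Finset.sum_le_sum fun x _ => ?_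
        by_cases h1 : B x y
        swap
        · rw [ind_not h1, zero_mul, zero_mul, mul_zero]
          exact mul_nonneg (powP_nonneg hP.1 x)
            (mul_nonneg (seqP_nonneg hV0 x y) (Real.exp_pos _).le)
        by_cases h2 : seqP V x y = 0
        · simp [h2]
        by_cases h3 : powP P x = 0
        · simp [h3]
        rw [ind_of h1, one_mul]
        refine mul_le_mul_of_nonneg_left (mul_le_mul_of_nonneg_left ?_ (seqP_nonneg hV0 x y))
          (powP_nonneg hP.1 x)
        have h4 : ∑ x', powP P x' * ind (¬ G x' y) ≤ Real.exp (-q) := by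
          have h5 : ∑ x', powP P x' * ind (¬ G x' y) = 1 - ∑ x', powP P x' * ind (G x' y) := by
            rw [← hp.2, ← Finset.sum_sub_distrib]
            refine Finset.sum_congr rfl fun x' _ => ?_
            by_cases hG : G x' y
            · rw [ind_of hG, ind_not (not_not.2 hG)]; ring
            · rw [ind_not hG, ind_of hG]; ring
          have h6 := Real.add_one_le_exp (-q)
          have h7 := h x y h1 h2 h3
          linarith
        have h8 : 0 ≤ ∑ x', powP P x' * ind (¬ G x' y) :=
          Finset.sum_nonneg fun x' _ => mul_nonneg (powP_nonneg hP.1 x') (ind_nonneg _)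
        rw [Finset.prod_const, Finset.card_erase_of_mem (Finset.mem_univ _), Finset.card_univ,
          Fintype.card_fin]
        refine (pow_le_pow_left₀ h8 h4 _).trans_eq ?_
        rw [← Real.exp_nat_mul, Nat.cast_sub (Nat.one_le_iff_ne_zero.2 (Fin.pos w).ne'),
          Nat.cast_one]
        congr 1
        ring
    _ = Real.exp (-(q * ((M : ℝ) - 1))) := by
        rw [Finset.sum_comm]
        simp only [← Finset.mul_sum, ← Finset.sum_mul, sum_seqP hV, one_mul]
        rw [hp.2, one_mul]

section
variable [Fintype 𝒳] [Fintype 𝒴] {P : 𝒳 → ℝ} {V V' : 𝒳 → 𝒴 → ℝ} {J K : 𝒳 → 𝒴 → ℝ}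

lemma localBound_of_better (hP : IsPMF P) (hV : IsChannel V) (hV0' : ∀ a b, 0 ≤ V' a b)
    {A : 𝒳 → 𝒴 → ℝ} (hJ : ∀ a b, 0 ≤ J a b) (hA : ∀ a b, 0 ≤ A a b)
    (hJX : ∀ a, ∑ b, J a b = P a) (hAX : ∀ a, ∑ b, A a b = P a)
    (hAY : ∀ b, ∑ a, A a b = ∑ a, J a b)
    (hAV : ∀ a b, A a b ≠ 0 → V a b ≠ 0) (hJV : ∀ a b, J a b ≠ 0 → V a b ≠ 0)
    {R : ℝ} (hR : 0 < R)
    (hI : ∑ a, ∑ b, A a b * Real.log (A a b / (P a * ∑ a', J a' b)) < R)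
    (hc : costJ V A < costJ V' K) (c : ℝ) : LocalBound P V V' R c J K := by
  have hV0 : ∀ a b, 0 ≤ V a b := fun k => (hV k).1
  obtain ⟨I, hI1, hI2⟩ := exists_between (max_lt hI hR)
  obtain ⟨θ, hθ1, hθ2⟩ := exists_between hc
  have hI0 : 0 < I := (le_max_right _ _).trans_lt hI1
  obtain ⟨U, hU, h⟩ := covering hP hV hJ hA hJX hAX hAY hAV hJV ((le_max_left _ _).trans_lt hI1) hθ1
  have hU' : {K' : 𝒳 → 𝒴 → ℝ | θ < costJ V' K'} ∈ nhds K :=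
    (continuous_costJ V').continuousAt.eventually (lt_mem_nhds hθ2)
  refine ⟨U ×ˢ {K' : 𝒳 → 𝒴 → ℝ | θ < costJ V' K'}, prod_mem_nhds hU hU', ?_⟩
  have hρ : 0 < (R - I) / 2 := by linarith
  filter_upwards [self_mem_nhdsWithin, nhdsWithin_le_nhds (gt_mem_nhds hρ)] with δ hδ hδ'
  have hδ : 0 < δ := hδ
  filter_upwards [h δ hδ, eventually_mul_le_exp_sub_one hρ c, Filter.eventually_gt_atTop 0]
    with n hn hnc hn0 M hM _ w
  calc confLoss n P δ V V' (U ×ˢ {K' : 𝒳 → 𝒴 → ℝ | θ < costJ V' K'}) w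
      ≤ EC (powP P) fun C : Fin M → Fin n → 𝒳 =>
          ∑ y, ind (emp (C w) y ∈ U ∧ Typ P δ (C w)) * seqP V (C w) y *
            ∏ v ∈ Finset.univ.erase w,
              ind (¬ (Typ P (2 * δ) (C v) ∧ Real.exp (-(n * θ)) < seqP V (C v) y)) := by
        refine EC_mono (powP_nonneg hP.1) fun C _ => ?_
        rw [Finset.mul_sum]
        refine Finset.sum_le_sum fun y _ => ?_
        have hnn : 0 ≤ ∏ v ∈ Finset.univ.erase w,
            ind (¬ (Typ P (2 * δ) (C v) ∧ Real.exp (-(n * θ)) < seqP V (C v) y)) :=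
          Finset.prod_nonneg fun v _ => ind_nonneg _
        by_cases h1 : Typ P δ (C w) ∧
          Confused P δ V V' (U ×ˢ {K' : 𝒳 → 𝒴 → ℝ | θ < costJ V' K'}) C w y
        · obtain ⟨ht, hconf⟩ := h1
          rw [ind_of ht, ind_of hconf, one_mul, one_mul]
          obtain ⟨w', -, -, hm, hv⟩ := hconf
          rw [ind_of ⟨hm.1, ht⟩, one_mul]
          rw [Finset.prod_eq_one, mul_one]
          intro v _
          refine ind_of ?_
          rintro ⟨hvt, hlt⟩
          have h2 : 0 < seqP V' (C w') y := (Real.exp_pos _).trans (hlt.trans_le (hv v hvt))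
          have h3 := hlt.trans_le (hv v hvt)
          rw [seqP_eq_exp_costJ hV0' h2.ne', Real.exp_lt_exp, neg_lt_neg_iff,
            mul_lt_mul_iff_right₀ (by exact_mod_cast hn0)] at h3
          exact absurd hm.2 (not_lt.2 h3.le)
        · have h2 : ind (Typ P δ (C w)) * (ind (Confused P δ V V'
              (U ×ˢ {K' : 𝒳 → 𝒴 → ℝ | θ < costJ V' K'}) C w y) * seqP V (C w) y) = 0 := by
            rw [← mul_assoc, ← ind_and, ind_not h1, zero_mul]
          rw [h2]
          exact mul_nonneg (mul_nonneg (ind_nonneg _) (seqP_nonneg hV0 _ _)) hnn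
    _ ≤ Real.exp (-(Real.exp (-(n * I)) * ((M : ℝ) - 1))) :=
        sum_EC_prod_not_le hP hV w (fun x y => emp x y ∈ U ∧ Typ P δ x)
          (fun x' y => Typ P (2 * δ) x' ∧ Real.exp (-(n * θ)) < seqP V x' y)
          fun x y hB h2 h3 => hn x y hB.1 hB.2 h2 h3
    _ ≤ Real.exp (-(n * c)) := by
        rw [Real.exp_le_exp, neg_le_neg_iff]
        refine hnc.trans ?_
        have h1 : Real.exp (-(n * I)) ≤ 1 := Real.exp_le_one_iff.2 (by
          rw [neg_nonpos]; positivity)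
        have h2 : Real.exp (n * ((R - I) / 2)) ≤ Real.exp (-(n * I)) * M := by
          calc Real.exp (n * ((R - I) / 2)) ≤ Real.exp (-(n * I) + n * (R - δ)) := by
                rw [Real.exp_le_exp]
                have : n * ((R - I) / 2) ≤ n * (R - I - δ) :=
                  mul_le_mul_of_nonneg_left (by linarith) (Nat.cast_nonneg n)
                linarith
            _ = Real.exp (-(n * I)) * Real.exp (n * (R - δ)) := Real.exp_add _ _
            _ ≤ _ := mul_le_mul_of_nonneg_left hM (Real.exp_pos _).le
        linarith

end

/-- Every pair of candidate joint types has a neighbourhood on which confusion of the state `s`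
with the state `s'` has exponent at least `c`, for any `c` below the joint exponent. -/
lemma localBound_of_le_rhoJoint [Fintype 𝒳] [Fintype 𝒴] {W : 𝒮 → 𝒳 → 𝒴 → ℝ}
    (hW : ∀ s, IsChannel (W s)) {P : 𝒳 → ℝ} (hP : IsPMF P) {R E : ℝ} (hR : 0 < R)
    (hE : ENNReal.ofReal E ≤ rhoJoint W P R) {s s' : 𝒮} (hs : s' ≠ s) {J K : 𝒳 → 𝒴 → ℝ}
    (hJ : ∀ a b, 0 ≤ J a b) (hK : ∀ a b, 0 ≤ K a b) {c : ℝ} (hc : c < E) :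
    LocalBound P (W s) (W s') R c J K := by
  have hV0 : ∀ s a b, 0 ≤ W s a b := fun s k => (hW s k).1
  by_cases hJX : ∀ a, ∑ b, J a b = P a
  swap
  · obtain ⟨a, ha⟩ := not_forall.1 hJX
    exact localBound_of_marginal_left_ne hP ha R c
  by_cases hKX : ∀ a, ∑ b, K a b = P a
  swap
  · obtain ⟨a, ha⟩ := not_forall.1 hKX
    exact localBound_of_marginal_right_ne hP ha R c
  by_cases hY : ∀ b, ∑ a, K a b = ∑ a, J a b
  swap
  · obtain ⟨b, hb⟩ := not_forall.1 hY
    exact localBound_of_output_ne hP hb R c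
  by_cases hJW : ∀ a b, J a b ≠ 0 → W s a b ≠ 0
  swap
  · push Not at hJW
    obtain ⟨a, b, h1, h2⟩ := hJW
    exact localBound_of_left_zero hP (lt_of_le_of_ne (hJ a b) (Ne.symm h1)) h2 R c
  by_cases hKW : ∀ a b, K a b ≠ 0 → W s' a b ≠ 0
  swap
  · push Not at hKW
    obtain ⟨a, b, h1, h2⟩ := hKW
    exact localBound_of_right_zero hP (hV0 s) (lt_of_le_of_ne (hK a b) (Ne.symm h1)) h2 R c
  by_cases hcost : costJ (W s') K ≤ costJ (W s) J
  swap
  · exact localBound_of_costJ_lt hP (hV0 s) (hV0 s') (not_le.1 hcost) R c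
  by_cases hD : divJ P (W s) J < E
  swap
  · exact localBound_of_lt_divJ hP (hW s) hJ hJX hJW (hc.trans_le (not_lt.1 hD)) R
  obtain ⟨A, hA, hAX, hAY, hAW, hI, hlt⟩ | h :=
    exists_better_or_le_of_le_rhoJoint hW hP hR.le hE hs hJ hK hJX hKX hY hJW hKW hcost hD
  · exact localBound_of_better hP (hW s) (hV0 s') hJ hA hJX hAX hAY hAW hJW hR hI hlt c
  · exact localBound_of_lt_divJ_add_infoJ hP (hW s) hJ hK hJX hKX hJW (hc.trans_le h)

/-- Some typical codeword, in state law `V'`, explains the output at least as well as every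
typical codeword does in state law `V`. -/
def Preferred {n M : ℕ} (P : 𝒳 → ℝ) (δ : ℝ) (V V' : 𝒳 → 𝒴 → ℝ) (C : Fin M → Fin n → 𝒳)
    (y : Fin n → 𝒴) : Prop :=
  ∃ w', Typ P (2 * δ) (C w') ∧ ∀ v, Typ P (2 * δ) (C v) → seqP V (C v) y ≤ seqP V' (C w') y

lemma emp_mem_Icc {κ α : Type} [Fintype α] {n : ℕ} (x : Fin n → κ) (y : Fin n → α) :
    emp x y ∈ Set.Icc (0 : κ → α → ℝ) 1 :=
  ⟨fun a b => emp_nonneg x y a b, fun a b => emp_le_one x y a b⟩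

lemma exists_eventually_preferred_le [Fintype 𝒳] [Fintype 𝒴] {W : 𝒮 → 𝒳 → 𝒴 → ℝ}
    (hW : ∀ s, IsChannel (W s)) {P : 𝒳 → ℝ} (hP : IsPMF P) {R E : ℝ} (hR : 0 < R)
    (hE : ENNReal.ofReal E ≤ rhoJoint W P R) {s s' : 𝒮} (hs : s' ≠ s) {c : ℝ} (hc : c < E)
    (hch : c < chernoffPair P (W s) (W s')) :
    ∃ L : ℝ, ∀ᶠ δ in nhdsWithin (0 : ℝ) (Set.Ioi 0), ∀ᶠ n : ℕ in Filter.atTop,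
      ∀ M : ℕ, Real.exp (n * (R - δ)) ≤ M → (M : ℝ) ≤ Real.exp (n * (R - δ)) + 1 →
        ∀ w : Fin M, EC (powP P) (fun C : Fin M → Fin n → 𝒳 => ind (Typ P δ (C w)) *
          ∑ y, ind (Preferred P δ (W s) (W s') C y) * seqP (W s) (C w) y)
            ≤ L * Real.exp (-(n * c)) := by
  have hV0 : ∀ s a b, 0 ≤ W s a b := fun s k => (hW s k).1
  have hcpt : IsCompact (Set.Icc (0 : 𝒳 → 𝒴 → ℝ) 1 ×ˢ Set.Icc (0 : 𝒳 → 𝒴 → ℝ) 1) :=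
    isCompact_Icc.prod isCompact_Icc
  have hloc : ∀ p ∈ Set.Icc (0 : 𝒳 → 𝒴 → ℝ) 1 ×ˢ Set.Icc (0 : 𝒳 → 𝒴 → ℝ) 1,
      LocalBound P (W s) (W s') R c p.1 p.2 := fun p hp =>
    localBound_of_le_rhoJoint hW hP hR hE hs (fun a b => hp.1.1 a b) (fun a b => hp.2.1 a b) hc
  choose! U hU hbd using hloc
  obtain ⟨t, ht, hcov⟩ := hcpt.elim_nhds_subcover U hU
  refine ⟨1 + t.card, ?_⟩
  filter_upwards [chernoff_typ (hV0 s) (hV0 s') hch,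
    (Filter.eventually_all_finset t).2 fun p hp => hbd p (ht p hp)] with δ hδ1 hδ2
  filter_upwards [(Filter.eventually_all_finset t).2 hδ2] with n hn M hM hM' w
  calc _ ≤ EC (powP P) (fun C : Fin M → Fin n → 𝒳 => Real.exp (-(n * c)) + ∑ p ∈ t,
        ind (Typ P δ (C w)) *
          ∑ y, ind (Confused P δ (W s) (W s') (U p) C w y) * seqP (W s) (C w) y) := by
        refine EC_mono (powP_nonneg hP.1) fun C _ => ?_
        by_cases hty : Typ P δ (C w)
        swap
        · simp only [ind_not hty, zero_mul, Finset.sum_const_zero, add_zero]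
          exact (Real.exp_pos _).le
        simp only [ind_of hty, one_mul]
        refine le_trans ?_ (add_le_add_left (hδ1 n (C w) hty) _)
        rw [Finset.sum_comm, ← Finset.sum_add_distrib]
        refine Finset.sum_le_sum fun y _ => ?_
        rw [← Finset.sum_mul, ← add_mul]
        refine mul_le_mul_of_nonneg_right ?_ (seqP_nonneg (hV0 s) _ _)
        refine le_trans (ind_mono (q := seqP (W s) (C w) y ≤ seqP (W s') (C w) y ∨
          ∃ p ∈ t, Confused P δ (W s) (W s') (U p) C w y) ?_)
          ((ind_or_le _ _).trans (add_le_add_right (ind_exists_mem_le t _) _))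
        rintro ⟨w', hw', hv⟩
        by_cases h : w' = w
        · subst h
          exact Or.inl (hv _ hw')
        · right
          have hmem : (emp (C w) y, emp (C w') y) ∈ ⋃ p ∈ t, U p :=
            hcov ⟨emp_mem_Icc _ _, emp_mem_Icc _ _⟩
          simp only [Set.mem_iUnion] at hmem
          obtain ⟨p, hp, hm⟩ := hmem
          exact ⟨p, hp, w', h, hw', hm, hv⟩
    _ = Real.exp (-(n * c)) + ∑ p ∈ t, confLoss n P δ (W s) (W s') (U p) w := by
        rw [EC_add, EC_const (isPMF_powP hP n), EC_sum]
        rfl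
    _ ≤ Real.exp (-(n * c)) + ∑ p ∈ t, Real.exp (-(n * c)) :=
        add_le_add_right (Finset.sum_le_sum fun p hp => hn p hp M hM hM' w) _
    _ = _ := by
        rw [Finset.sum_const, nsmul_eq_mul]
        ring

/-- Wrong state estimation has, on average over the random codebook, exponent at least any `c`
below the joint exponent and the Chernoff exponent. -/
lemma exists_eventually_detection_le [Fintype 𝒳] [Fintype 𝒴] [Fintype 𝒮] {W : 𝒮 → 𝒳 → 𝒴 → ℝ}
    (hW : ∀ s, IsChannel (W s)) {P : 𝒳 → ℝ} (hP : IsPMF P) {R E : ℝ} (hR : 0 < R)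
    (hE : ENNReal.ofReal E ≤ rhoJoint W P R) (hE2 : E ≤ phi W P) {c : ℝ} (hc : c < E) (s : 𝒮) :
    ∃ L : ℝ, ∀ᶠ δ in nhdsWithin (0 : ℝ) (Set.Ioi 0), ∀ᶠ n : ℕ in Filter.atTop,
      ∀ M : ℕ, Real.exp (n * (R - δ)) ≤ M → (M : ℝ) ≤ Real.exp (n * (R - δ)) + 1 →
        ∀ w : Fin M, EC (powP P) (fun C : Fin M → Fin n → 𝒳 => ind (Typ P δ (C w)) *
          ∑ y, ind (∃ s', s' ≠ s ∧ Preferred P δ (W s) (W s') C y) * seqP (W s) (C w) y)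
            ≤ L * Real.exp (-(n * c)) := by
  classical
  have hV0 : ∀ s a b, 0 ≤ W s a b := fun s k => (hW s k).1
  have hch : ∀ s', s' ≠ s → c < chernoffPair P (W s) (W s') := fun s' hs' =>
    hc.trans_le (hE2.trans ((ciInf_le (Set.finite_range _).bddBelow s).trans
      (csInf_le ((Set.toFinite _).image _).bddBelow (Set.mem_image_of_mem _ hs'))))
  have h1 : ∀ s', s' ≠ s → _ := fun s' hs' =>
    exists_eventually_preferred_le hW hP hR hE hs' hc (hch s' hs')
  choose! L hL using h1
  set t := Finset.univ.filter fun s' : 𝒮 => s' ≠ s with ht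
  have hmem : ∀ {s'}, s' ∈ t → s' ≠ s := fun h => (Finset.mem_filter.1 h).2
  refine ⟨∑ s' ∈ t, L s', ?_⟩
  filter_upwards [(Filter.eventually_all_finset t).2 fun s' hs' => hL s' (hmem hs')] with δ hδ
  filter_upwards [(Filter.eventually_all_finset t).2 hδ] with n hn M hM hM' w
  calc _ ≤ EC (powP P) (fun C : Fin M → Fin n → 𝒳 => ∑ s' ∈ t, ind (Typ P δ (C w)) *
          ∑ y, ind (Preferred P δ (W s) (W s') C y) * seqP (W s) (C w) y) := by
        refine EC_mono (powP_nonneg hP.1) fun C _ => ?_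
        rw [← Finset.mul_sum, Finset.sum_comm]
        refine mul_le_mul_of_nonneg_left (Finset.sum_le_sum fun y _ => ?_) (ind_nonneg _)
        rw [← Finset.sum_mul]
        refine mul_le_mul_of_nonneg_right ?_ (seqP_nonneg (hV0 s) _ _)
        refine le_trans (ind_mono ?_) (ind_exists_mem_le t _)
        rintro ⟨s', hs', h⟩
        exact ⟨s', Finset.mem_filter.2 ⟨Finset.mem_univ _, hs'⟩, h⟩
    _ ≤ _ := by
        rw [EC_sum, Finset.sum_mul]
        exact Finset.sum_le_sum fun s' hs' => hn s' hs' M hM hM' w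

/-- Threshold decoding on joint types: the average decoding error vanishes below capacity. -/
lemma exists_eventually_decoding_le [Fintype 𝒳] [Fintype 𝒴] [Fintype 𝒮] {W : 𝒮 → 𝒳 → 𝒴 → ℝ}
    (hW : ∀ s, IsChannel (W s)) {P : 𝒳 → ℝ} (hP : IsPMF P) {R : ℝ}
    (hR : R ≤ ⨅ s, mutualInfo P (W s)) {δ : ℝ} (hδ : 0 < δ) :
    ∃ U : 𝒮 → Set (𝒳 → 𝒴 → ℝ), ∀ η > 0, ∀ᶠ n : ℕ in Filter.atTop,
      ∀ M : ℕ, (M : ℝ) ≤ Real.exp (n * (R - δ)) + 1 → ∀ (s : 𝒮) (w : Fin M),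
        EC (powP P) (fun C : Fin M → Fin n → 𝒳 =>
          ∑ y, ind (emp (C w) y ∉ U s ∨ ∃ w', w' ≠ w ∧ ∃ s', emp (C w') y ∈ U s') *
            seqP (W s) (C w) y) ≤ η := by
  have hV0 : ∀ s a b, 0 ≤ W s a b := fun s k => (hW s k).1
  have h1 : ∀ s, ∃ U ∈ nhds (fun a b => P a * W s a b), ∀ (n : ℕ) (y : Fin n → 𝒴),
      ∑ x : Fin n → 𝒳, powP P x * ind (emp x y ∈ U) ≤ Real.exp (-(n * (R - δ / 2))) := fun s =>
    exists_nhds_sum_powP_emp_mem_le hP (fun a b => mul_nonneg (hP.1 a) (hV0 s a b))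
      (fun a => by rw [← Finset.mul_sum, (hW s a).2, mul_one]) (by
        rw [← mutualInfo_eq_infoJ fun _ _ => rfl]
        have := hR.trans (ciInf_le (Set.finite_range _).bddBelow s)
        linarith)
  choose U hU hbd using h1
  refine ⟨U, fun η hη => ?_⟩
  have e1 : ∀ᶠ n : ℕ in Filter.atTop, ∀ s, ∑ x : Fin n → 𝒳, powP P x *
      ∑ y : Fin n → 𝒴, ind (emp x y ∉ U s) * seqP (W s) x y < η / 2 :=
    Filter.eventually_all.2 fun s =>
      (tendsto_emp_not_mem hP (hW s) (hU s)).eventually (gt_mem_nhds (half_pos hη))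
  have e2 : ∀ᶠ n : ℕ in Filter.atTop,
      2 * Fintype.card 𝒮 * Real.exp (-(n * (δ / 2))) < η / 2 := by
    have := (tendsto_exp_neg_nat_mul (half_pos hδ)).const_mul (2 * (Fintype.card 𝒮 : ℝ))
    rw [mul_zero] at this
    exact this.eventually (gt_mem_nhds (half_pos hη))
  filter_upwards [e1, e2] with n hn1 hn2 M hM s w
  calc _ ≤ EC (powP P) (fun C : Fin M → Fin n → 𝒳 =>
          (∑ y, ind (emp (C w) y ∉ U s) * seqP (W s) (C w) y) +
          ∑ w' ∈ Finset.univ.erase w, ∑ s',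
            ∑ y, ind (emp (C w') y ∈ U s') * seqP (W s) (C w) y) := by
        refine EC_mono (powP_nonneg hP.1) fun C _ => ?_
        have hcomm : ∑ w' ∈ Finset.univ.erase w, ∑ s', ∑ y,
            ind (emp (C w') y ∈ U s') * seqP (W s) (C w) y
            = ∑ y, ∑ w' ∈ Finset.univ.erase w, ∑ s',
              ind (emp (C w') y ∈ U s') * seqP (W s) (C w) y :=
          (Finset.sum_congr rfl fun w' _ => Finset.sum_comm).trans Finset.sum_comm
        rw [hcomm, ← Finset.sum_add_distrib]
        refine Finset.sum_le_sum fun y _ => ?_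
        simp only [← Finset.sum_mul]
        rw [← add_mul]
        refine mul_le_mul_of_nonneg_right ?_ (seqP_nonneg (hV0 s) _ _)
        refine (ind_or_le _ _).trans (add_le_add_right ?_ _)
        refine (le_trans (ind_mono ?_) (ind_exists_mem_le (Finset.univ.erase w)
          fun w' => ∃ s', emp (C w') y ∈ U s')).trans
          (Finset.sum_le_sum fun w' _ => ind_exists_le _)
        rintro ⟨w', hw', h⟩
        exact ⟨w', Finset.mem_erase.2 ⟨hw', Finset.mem_univ _⟩, h⟩
    _ = (∑ x : Fin n → 𝒳, powP P x *
          ∑ y : Fin n → 𝒴, ind (emp x y ∉ U s) * seqP (W s) x y) +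
        ∑ w' ∈ Finset.univ.erase w, ∑ s', ∑ x : Fin n → 𝒳, powP P x *
          ∑ x' : Fin n → 𝒳, powP P x' * ∑ y, ind (emp x' y ∈ U s') * seqP (W s) x y := by
        rw [EC_add, EC_single (isPMF_powP hP n) w
          fun x => ∑ y, ind (emp x y ∉ U s) * seqP (W s) x y, EC_sum]
        congr 1
        refine Finset.sum_congr rfl fun w' hw' => ?_
        rw [EC_sum]
        refine Finset.sum_congr rfl fun s' _ => ?_
        exact EC_pair (isPMF_powP hP n) (Finset.ne_of_mem_erase hw')
          fun x x' => ∑ y, ind (emp x' y ∈ U s') * seqP (W s) x y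
    _ ≤ η / 2 + ∑ w' ∈ (Finset.univ : Finset (Fin M)).erase w, ∑ s' : 𝒮,
          Real.exp (-(n * (R - δ / 2))) := by
        refine add_le_add (hn1 s).le (Finset.sum_le_sum fun w' _ => Finset.sum_le_sum fun s' _ => ?_)
        refine (Finset.sum_le_sum fun x _ => mul_le_mul_of_nonneg_left (?_ : _ ≤
          Real.exp (-(n * (R - δ / 2)))) (powP_nonneg hP.1 x)).trans_eq ?_
        · calc ∑ x' : Fin n → 𝒳, powP P x' * ∑ y, ind (emp x' y ∈ U s') * seqP (W s) x y
              = ∑ y, seqP (W s) x y * ∑ x' : Fin n → 𝒳, powP P x' * ind (emp x' y ∈ U s') := by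
                simp only [Finset.mul_sum]
                rw [Finset.sum_comm]
                exact Finset.sum_congr rfl fun y _ => Finset.sum_congr rfl fun x' _ => by ring
            _ ≤ ∑ y, seqP (W s) x y * Real.exp (-(n * (R - δ / 2))) :=
                Finset.sum_le_sum fun y _ => mul_le_mul_of_nonneg_left (hbd s' n y)
                  (seqP_nonneg (hV0 s) _ _)
            _ = _ := by rw [← Finset.sum_mul, sum_seqP (hW s), one_mul]
        · rw [← Finset.sum_mul, (isPMF_powP hP n).2, one_mul]
    _ ≤ η / 2 + 2 * Fintype.card 𝒮 * Real.exp (-(n * (δ / 2))) := by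
        refine add_le_add_right ?_ _
        simp only [Finset.sum_const, nsmul_eq_mul, Finset.card_univ]
        have h2 : (((Finset.univ : Finset (Fin M)).erase w).card : ℝ)
            ≤ Real.exp (n * (R - δ)) := by
          rw [Finset.card_erase_of_mem (Finset.mem_univ _), Finset.card_univ, Fintype.card_fin,
            Nat.cast_sub (Nat.one_le_iff_ne_zero.2 (Fin.pos w).ne'), Nat.cast_one]
          linarith
        have h3 : Real.exp (n * (R - δ)) * Real.exp (-(n * (R - δ / 2)))
            = Real.exp (-(n * (δ / 2))) := by
          rw [← Real.exp_add]
          congr 1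
          ring
        calc _ ≤ Real.exp (n * (R - δ)) *
                (Fintype.card 𝒮 * Real.exp (-(n * (R - δ / 2)))) :=
              mul_le_mul_of_nonneg_right h2 (by positivity)
          _ = Fintype.card 𝒮 * Real.exp (-(n * (δ / 2))) := by rw [← h3]; ring
          _ ≤ _ := by
              have : 0 ≤ Fintype.card 𝒮 * Real.exp (-(n * (δ / 2))) := by positivity
              linarith
    _ ≤ η := by linarith

/-- Expurgation: a random codebook with small average cost contains one in which half of the
messages have small cost. -/
lemma exists_expurgation {β : Type} [Fintype β] {M : ℕ} (hM : 0 < M) {p : β → ℝ} (hp : IsPMF p)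
    (F : (Fin M → β) → Fin M → ℝ) (hF : ∀ C w, 0 ≤ F C w)
    (h : ∀ w, EC p (fun C => F C w) ≤ 1 / 4) :
    ∃ (C : Fin M → β) (G : Finset (Fin M)), (M : ℝ) / 2 ≤ G.card ∧ ∀ w ∈ G, F C w < 1 := by
  classical
  have h1 : EC p (fun C => ∑ w, F C w) < M / 2 := by
    rw [EC_sum]
    refine (Finset.sum_le_sum fun w _ => h w).trans_lt ?_
    have : (0 : ℝ) < M := by exact_mod_cast hM
    rw [Finset.sum_const, Finset.card_univ, Fintype.card_fin, nsmul_eq_mul]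
    linarith
  obtain ⟨C, hC⟩ := exists_le_of_EC_le hp h1
  refine ⟨C, Finset.univ.filter fun w => F C w < 1, ?_, fun w hw => (Finset.mem_filter.1 hw).2⟩
  have h2 : ((Finset.univ.filter fun w => ¬ F C w < 1).card : ℝ) ≤ ∑ w, F C w := by
    rw [← nsmul_one, ← Finset.sum_const]
    refine (Finset.sum_le_sum fun w hw => not_lt.1 (Finset.mem_filter.1 hw).2).trans ?_
    exact Finset.sum_le_sum_of_subset_of_nonneg (Finset.filter_subset _ _) fun w _ _ => hF C w
  have h3 := Finset.card_filter_add_card_filter_not (s := (Finset.univ : Finset (Fin M)))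
    (fun w => F C w < 1)
  rw [Finset.card_univ, Fintype.card_fin] at h3
  have h4 : ((Finset.univ.filter fun w => F C w < 1).card : ℝ)
      + (Finset.univ.filter fun w => ¬ F C w < 1).card = M := by exact_mod_cast h3
  linarith

/-- A joint maximum-likelihood state estimator over the typical codewords. -/
lemma exists_state_estimator [Finite 𝒮] [Nonempty 𝒮] (W : 𝒮 → 𝒳 → 𝒴 → ℝ) {n M : ℕ} (P : 𝒳 → ℝ)
    (δ : ℝ) (C : Fin M → Fin n → 𝒳) : ∃ g : (Fin n → 𝒴) → 𝒮, ∀ s y,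
      (∃ v, Typ P (2 * δ) (C v)) → g y ≠ s →
        ∃ s', s' ≠ s ∧ Preferred P δ (W s) (W s') C y := by
  suffices h : ∀ y : Fin n → 𝒴, ∃ s₀ : 𝒮, ∀ s, (∃ v, Typ P (2 * δ) (C v)) → s₀ ≠ s →
      ∃ s', s' ≠ s ∧ Preferred P δ (W s) (W s') C y by
    choose g hg using h
    exact ⟨g, fun s y => hg y s⟩
  intro y
  by_cases h : ∃ v, Typ P (2 * δ) (C v)
  · obtain ⟨v, hv⟩ := h
    obtain ⟨s₁⟩ := ‹Nonempty 𝒮›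
    obtain ⟨⟨s₀, w'⟩, hm, hmax⟩ := Set.exists_max_image
      {q : 𝒮 × Fin M | Typ P (2 * δ) (C q.2)} (fun q => seqP (W q.1) (C q.2) y)
      (Set.toFinite _) ⟨(s₁, v), hv⟩
    exact ⟨s₀, fun s _ hs => ⟨s₀, hs, w', hm, fun v' hv' => hmax (s, v') hv'⟩⟩
  · exact ⟨Classical.arbitrary 𝒮, fun s h' => absurd h' h⟩

/-- A decoder that picks a codeword jointly typical with the output. -/
lemma exists_decoder {n M : ℕ} (hM : 0 < M) (U : 𝒮 → Set (𝒳 → 𝒴 → ℝ)) (C : Fin M → Fin n → 𝒳) :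
    ∃ h : (Fin n → 𝒴) → Fin M, ∀ s w y, h y ≠ w →
      emp (C w) y ∉ U s ∨ ∃ w', w' ≠ w ∧ ∃ s', emp (C w') y ∈ U s' := by
  suffices h : ∀ y : Fin n → 𝒴, ∃ w₀ : Fin M, ∀ (s : 𝒮) w, w₀ ≠ w →
      emp (C w) y ∉ U s ∨ ∃ w', w' ≠ w ∧ ∃ s', emp (C w') y ∈ U s' by
    choose g hg using h
    exact ⟨g, fun s w y => hg y s w⟩
  intro y
  by_cases h : ∃ w₀ : Fin M, ∃ s', emp (C w₀) y ∈ U s'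
  · obtain ⟨w₀, hw₀⟩ := h
    exact ⟨w₀, fun s w hw => Or.inr ⟨w₀, hw, hw₀⟩⟩
  · exact ⟨⟨0, hM⟩, fun s w _ => Or.inl fun hm => h ⟨w, s, hm⟩⟩

lemma biProbEvent_le [Fintype 𝒴] {n : ℕ} {W : 𝒮 → 𝒳 → 𝒴 → ℝ} (hW : ∀ s a b, 0 ≤ W s a b)
    (x : Fin n → 𝒳) (s : 𝒮) {A B : (Fin n → 𝒴) → Prop} (h : ∀ y, A y → B y) :
    biProbEvent W x s A ≤ ∑ y, ind (B y) * seqP (W s) x y := by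
  refine Finset.sum_le_sum fun y _ => ?_
  split_ifs with hA
  · rw [ind_of (h y hA), one_mul]
    rfl
  · exact mul_nonneg (ind_nonneg _) (seqP_nonneg (hW s) _ _)

/-- For suitable typicality slack and block length, some codebook has at least `exp (n (R - ε))`
messages with typical codewords, decoding error at most `ε`, and detection error exponent at
least `E - ε`. -/
lemma exists_good_codebook [Fintype 𝒳] [Fintype 𝒴] [Fintype 𝒮] {W : 𝒮 → 𝒳 → 𝒴 → ℝ}
    (hW : ∀ s, IsChannel (W s)) {P : 𝒳 → ℝ} (hP : IsPMF P) {R E : ℝ} (hR0 : 0 < R)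
    (hR : R ≤ ⨅ s, mutualInfo P (W s)) (hE1 : ENNReal.ofReal E ≤ rhoJoint W P R)
    (hE2 : E ≤ phi W P) {ε : ℝ} (hε : 0 < ε) :
    ∃ (n M : ℕ) (C : Fin M → Fin n → 𝒳) (G : Finset (Fin M)) (U : 𝒮 → Set (𝒳 → 𝒴 → ℝ)) (δ : ℝ),
      0 < n ∧ Real.exp (n * (R - ε)) ≤ G.card ∧ ∀ w ∈ G, Typ P (2 * δ) (C w) ∧ ∀ s,
        ∑ y, ind (emp (C w) y ∉ U s ∨ ∃ w', w' ≠ w ∧ ∃ s', emp (C w') y ∈ U s') *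
          seqP (W s) (C w) y ≤ ε ∧
        ∑ y, ind (∃ s', s' ≠ s ∧ Preferred P δ (W s) (W s') C y) * seqP (W s) (C w) y
          ≤ Real.exp (-(n * (E - ε))) := by
  have hV0 : ∀ s a b, 0 ≤ W s a b := fun s k => (hW s k).1
  have hdet := fun s => exists_eventually_detection_le hW hP hR0 hE1 hE2
    (show E - ε / 2 < E by linarith) s
  choose L hL using hdet
  obtain ⟨δ, ⟨hδ1, hδ2⟩, hδ0⟩ := (((Filter.eventually_all.2 hL).and
    (nhdsWithin_le_nhds (gt_mem_nhds (half_pos hε)))).and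
    (self_mem_nhdsWithin (s := Set.Ioi (0 : ℝ)))).exists
  have hδ0 : 0 < δ := hδ0
  obtain ⟨U, hU⟩ := exists_eventually_decoding_le hW hP hR hδ0
  set S : ℝ := (Fintype.card 𝒮 : ℝ) with hS
  have hS0 : 0 ≤ S := Nat.cast_nonneg _
  have e2 := hU (ε / (12 * (S + 1))) (by positivity)
  have e3 : ∀ᶠ n : ℕ in Filter.atTop,
      ∑ z : Fin n → 𝒳, powP P z * ind (¬ Typ P δ z) < 1 / 12 :=
    (tendsto_not_typ hP hδ0).eventually (gt_mem_nhds (by norm_num))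
  have e4 : ∀ᶠ n : ℕ in Filter.atTop, (∑ s, L s) * Real.exp (-(n * (ε / 2))) < 1 / 12 := by
    have := (tendsto_exp_neg_nat_mul (half_pos hε)).const_mul (∑ s, L s)
    rw [mul_zero] at this
    exact this.eventually (gt_mem_nhds (by norm_num))
  have e5 : ∀ᶠ n : ℕ in Filter.atTop, Real.exp (-(n * (ε / 2))) < 1 / 2 :=
    (tendsto_exp_neg_nat_mul (half_pos hε)).eventually (gt_mem_nhds (by norm_num))
  obtain ⟨n, hn1, hn2, hn3, hn4, hn5, hn0⟩ := ((Filter.eventually_all.2 hδ1).and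
    (e2.and (e3.and (e4.and (e5.and (Filter.eventually_gt_atTop 0)))))).exists
  set M : ℕ := ⌈Real.exp (n * (R - δ))⌉₊ with hMdef
  have hM1 : Real.exp (n * (R - δ)) ≤ M := Nat.le_ceil _
  have hM2 : (M : ℝ) ≤ Real.exp (n * (R - δ)) + 1 := (Nat.ceil_lt_add_one (Real.exp_pos _).le).le
  have hM0 : 0 < M := Nat.ceil_pos.2 (Real.exp_pos _)
  have hp := isPMF_powP hP n
  set dec : (Fin M → Fin n → 𝒳) → Fin M → 𝒮 → ℝ := fun C w s =>
    ∑ y, ind (emp (C w) y ∉ U s ∨ ∃ w', w' ≠ w ∧ ∃ s', emp (C w') y ∈ U s') *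
      seqP (W s) (C w) y with hdec
  set det : (Fin M → Fin n → 𝒳) → Fin M → 𝒮 → ℝ := fun C w s =>
    ∑ y, ind (∃ s', s' ≠ s ∧ Preferred P δ (W s) (W s') C y) * seqP (W s) (C w) y with hdetdef
  have hdec0 : ∀ C w s, 0 ≤ dec C w s := fun C w s => Finset.sum_nonneg fun y _ =>
    mul_nonneg (ind_nonneg _) (seqP_nonneg (hV0 s) _ _)
  have hdet0 : ∀ C w s, 0 ≤ det C w s := fun C w s => Finset.sum_nonneg fun y _ =>
    mul_nonneg (ind_nonneg _) (seqP_nonneg (hV0 s) _ _)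
  set F : (Fin M → Fin n → 𝒳) → Fin M → ℝ := fun C w =>
    ind (¬ Typ P δ (C w)) + ((∑ s, ε⁻¹ * dec C w s) +
      ∑ s, Real.exp (n * (E - ε)) * (ind (Typ P δ (C w)) * det C w s)) with hF
  have hdecs : ∀ C w, 0 ≤ ∑ s, ε⁻¹ * dec C w s := fun C w =>
    Finset.sum_nonneg fun s _ => mul_nonneg (inv_nonneg.2 hε.le) (hdec0 C w s)
  have hdets : ∀ C w, 0 ≤ ∑ s, Real.exp (n * (E - ε)) * (ind (Typ P δ (C w)) * det C w s) :=
    fun C w => Finset.sum_nonneg fun s _ =>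
      mul_nonneg (Real.exp_pos _).le (mul_nonneg (ind_nonneg _) (hdet0 C w s))
  have havg : ∀ w, EC (powP P) (fun C => F C w) ≤ 1 / 4 := by
    intro w
    simp only [hF]
    rw [EC_add, EC_add, EC_sum, EC_sum, EC_single hp w fun x => ind (¬ Typ P δ x)]
    simp only [EC_mul_left]
    have h2 : ∑ s, ε⁻¹ * EC (powP P) (fun C => dec C w s) ≤ 1 / 12 := by
      refine (Finset.sum_le_sum fun s _ => mul_le_mul_of_nonneg_left (hn2 M hM2 s w)
        (inv_nonneg.2 hε.le)).trans ?_
      rw [Finset.sum_const, Finset.card_univ, nsmul_eq_mul, ← hS]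
      have : S * (ε⁻¹ * (ε / (12 * (S + 1)))) = S / (S + 1) / 12 := by field_simp
      rw [this]
      have : S / (S + 1) ≤ 1 := (div_le_one (by positivity)).2 (by linarith)
      linarith
    have h3 : ∑ s, Real.exp (n * (E - ε)) *
        EC (powP P) (fun C => ind (Typ P δ (C w)) * det C w s) ≤ 1 / 12 := by
      refine (Finset.sum_le_sum fun s _ => mul_le_mul_of_nonneg_left (hn1 s M hM1 hM2 w)
        (Real.exp_pos _).le).trans (le_trans (le_of_eq ?_) hn4.le)
      rw [Finset.sum_mul]
      refine Finset.sum_congr rfl fun s _ => ?_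
      rw [mul_left_comm, ← Real.exp_add]
      congr 2
      ring
    linarith
  obtain ⟨C, G, hG, hgood⟩ := exists_expurgation hM0 hp F
    (fun C w => add_nonneg (ind_nonneg _) (add_nonneg (hdecs C w) (hdets C w))) havg
  refine ⟨n, M, C, G, U, δ, hn0, ?_, fun w hw => ?_⟩
  · calc Real.exp (n * (R - ε)) ≤ Real.exp (n * (R - δ) + -(n * (ε / 2))) := by
          rw [Real.exp_le_exp]
          have : n * δ ≤ n * (ε / 2) := mul_le_mul_of_nonneg_left hδ2.le (Nat.cast_nonneg n)
          linarith
      _ = Real.exp (n * (R - δ)) * Real.exp (-(n * (ε / 2))) := Real.exp_add _ _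
      _ ≤ M * (1 / 2) := mul_le_mul hM1 hn5.le (Real.exp_pos _).le (Nat.cast_nonneg _)
      _ ≤ G.card := by linarith
  · have h1 : ind (¬ Typ P δ (C w)) + ((∑ s, ε⁻¹ * dec C w s) +
      ∑ s, Real.exp (n * (E - ε)) * (ind (Typ P δ (C w)) * det C w s)) < 1 := hgood w hw
    have hty : Typ P δ (C w) := by
      by_contra hcon
      rw [ind_of hcon] at h1
      linarith [hdecs C w, hdets C w]
    rw [ind_not (not_not.2 hty)] at h1
    refine ⟨fun a => (hty a).trans (by linarith), fun s => ⟨?_, ?_⟩⟩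
    · have h2 : ε⁻¹ * dec C w s ≤ ∑ s, ε⁻¹ * dec C w s :=
        Finset.single_le_sum (f := fun s => ε⁻¹ * dec C w s)
          (fun s _ => mul_nonneg (inv_nonneg.2 hε.le) (hdec0 C w s)) (Finset.mem_univ s)
      have h3 : ε⁻¹ * dec C w s ≤ 1 := by linarith [hdets C w]
      rwa [inv_mul_le_iff₀ hε, mul_one] at h3
    · have h2 : Real.exp (n * (E - ε)) * (ind (Typ P δ (C w)) * det C w s)
          ≤ ∑ s, Real.exp (n * (E - ε)) * (ind (Typ P δ (C w)) * det C w s) :=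
        Finset.single_le_sum
          (f := fun s => Real.exp (n * (E - ε)) * (ind (Typ P δ (C w)) * det C w s))
          (fun s _ => mul_nonneg (Real.exp_pos _).le (mul_nonneg (ind_nonneg _) (hdet0 C w s)))
          (Finset.mem_univ s)
      have h3 : Real.exp (n * (E - ε)) * det C w s ≤ 1 := by
        have h3 := h2.trans (b := _) (c := (1 : ℝ)) (by linarith [hdecs C w])
        rwa [ind_of hty, one_mul] at h3
      rw [Real.exp_neg]
      rwa [← le_inv_mul_iff₀ (Real.exp_pos _), mul_one] at h3

lemma biAchievable_of_le [Fintype 𝒳] [Fintype 𝒴] [Fintype 𝒮] [Nonempty 𝒮] {W : 𝒮 → 𝒳 → 𝒴 → ℝ}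
    (hW : ∀ s, IsChannel (W s)) {P : 𝒳 → ℝ} (hP : IsPMF P) {R E : ℝ} (hR0 : 0 < R)
    (hR : R ≤ ⨅ s, mutualInfo P (W s)) (hE1 : ENNReal.ofReal E ≤ rhoJoint W P R)
    (hE2 : E ≤ phi W P) : BiAchievable W R E := by
  classical
  have hV0 : ∀ s a b, 0 ≤ W s a b := fun s k => (hW s k).1
  intro ε hε
  obtain ⟨n, M, C, G, U, δ, hn, hG, hgood⟩ := exists_good_codebook hW hP hR0 hR hE1 hE2 hε
  have hGpos : (0 : ℝ) < G.card := (Real.exp_pos _).trans_le hG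
  have hG0 : 0 < G.card := by exact_mod_cast hGpos
  obtain ⟨w₀, -⟩ := Finset.card_pos.1 hG0
  obtain ⟨g, hg⟩ := exists_state_estimator W P δ C
  obtain ⟨h, hh⟩ := exists_decoder (Fin.pos w₀) U C
  let e : Fin G.card ≃ G := G.equivFin.symm
  refine ⟨n, G.card, fun i => C (e i), g,
    fun y => if hy : h y ∈ G then e.symm ⟨h y, hy⟩ else ⟨0, hG0⟩, hn, hG0, ?_, ?_, ?_⟩
  · rw [le_div_iff₀ (by exact_mod_cast hn), mul_comm]
    exact (Real.le_log_iff_exp_le hGpos).2 hG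
  · refine fun s i => (biProbEvent_le hV0 _ s fun y hy => hh s (e i) y ?_).trans
      ((hgood _ (e i).2).2 s).1
    intro h0
    apply hy
    have hmem : h y ∈ G := h0 ▸ (e i).2
    exact (dif_pos hmem).trans ((Equiv.symm_apply_eq e).2 (Subtype.ext h0))
  · intro s i
    rw [neg_mul]
    exact (biProbEvent_le hV0 _ s fun y hy => hg s y ⟨_, (hgood _ (e i).2).1⟩ hy).trans
      ((hgood _ (e i).2).2 s).2

/-- Theorem 7 of the paper: bi-static joint decoding-and-detection
inner bound. -/
theorem biStatic_joint_innerBound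
    [Fintype 𝒳] [Fintype 𝒴] [Fintype 𝒮] [Nonempty 𝒳] [Nonempty 𝒮]
    (W : 𝒮 → 𝒳 → 𝒴 → ℝ) (hW : ∀ s, IsChannel (W s))
    (hSA : StandingAssumption W)
    (P : 𝒳 → ℝ) (hP : IsPMF P)
    (R E : ℝ) (hR0 : 0 < R) (hE0 : 0 ≤ E)
    (hR : R ≤ ⨅ s, mutualInfo P (W s))
    (hE1 : ENNReal.ofReal E ≤ rhoJoint W P R)
    (hE2 : E ≤ phi W P) :
    (R, E) ∈ Cbi W := by
  exact subset_closure ⟨hR0.le, hE0, biAchievable_of_le hW hP hR0 hR hE1 hE2⟩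

end JCAS
end

section
/- Joint detection dominates successive detection: For every probability distribution P_X on 𝒳 and every R > 0, ρ_joint(P_X,R) ≥ ρ_succ(P_X,R). -/
open scoped BigOperators ENNReal NNReal

namespace JCAS

variable {𝒳 𝒴 𝒵 𝒮 : Type}

/-- Subtracting a finite constant commutes with infima in `ℝ≥0∞`. -/
theorem iInf_sub_of_ne_top {ι : Sort*} (f : ι → ℝ≥0∞) {a : ℝ≥0∞} (ha : a ≠ ⊤) :
    (⨅ i, f i) - a = ⨅ i, f i - a :=
  Monotone.map_iInf_of_continuousAt (f := fun x : ℝ≥0∞ => x - a)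
    (ENNReal.continuous_sub_right a).continuousAt (fun _ _ h => tsub_le_tsub_right h a)
    (ENNReal.top_sub ha)

/-- `I(P, V) = H(P ∘ V) - H(V | P)`. -/
theorem mutualInfo_eq_ent_sub_condH [Fintype 𝒳] [Fintype 𝒴] {P : 𝒳 → ℝ} {V : 𝒳 → 𝒴 → ℝ}
    (hP : ∀ x, 0 ≤ P x) (hV : ∀ x y, 0 ≤ V x y) :
    mutualInfo P V = ent (outDist P V) - condH P V := by
  have hterm : ∀ x y, P x * V x y * Real.log (V x y / ∑ x', P x' * V x' y) =
      P x * V x y * Real.log (V x y) - P x * V x y * Real.log (outDist P V y) := by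
    intro x y
    by_cases h : P x * V x y = 0
    · simp [h]
    · have hout : P x * V x y ≤ outDist P V y :=
        Finset.single_le_sum (f := fun x' => P x' * V x' y)
          (fun x' _ => mul_nonneg (hP x') (hV x' y)) (Finset.mem_univ x)
      have hpos : 0 < P x * V x y := lt_of_le_of_ne' (mul_nonneg (hP x) (hV x y)) h
      have hlog : Real.log (V x y / outDist P V y) =
          Real.log (V x y) - Real.log (outDist P V y) :=
        Real.log_div (right_ne_zero_of_mul h) (hpos.trans_le hout).ne'
      rw [← mul_sub, ← hlog, outDist]
  have hent : ∑ x, ∑ y, P x * V x y * Real.log (outDist P V y) = -ent (outDist P V) := by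
    rw [Finset.sum_comm, ent, neg_neg]
    refine Finset.sum_congr rfl fun y _ => ?_
    rw [← Finset.sum_mul, outDist]
  simp only [mutualInfo, hterm, Finset.sum_sub_distrib, hent, condH]
  ring

/-- If `D(Q'‖W'|P) + H(Q'|P) ≤ D(Q‖W|P) + H(Q|P)` and `H(Q|P) ≤ H(Q'|P)`, then
`D(Q'‖W'|P) ≤ D(Q‖W|P)`. -/
theorem condKL_le_of_add_condH_le [Fintype 𝒳] [Fintype 𝒴] {P : 𝒳 → ℝ}
    {Q Q' V V' : 𝒳 → 𝒴 → ℝ}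
    (h : condKL P Q' V' + ENNReal.ofReal (condH P Q') ≤
      condKL P Q V + ENNReal.ofReal (condH P Q))
    (hH : condH P Q ≤ condH P Q') : condKL P Q' V' ≤ condKL P Q V :=
  (ENNReal.add_le_add_iff_right ENNReal.ofReal_ne_top).1
    (h.trans (by gcongr))

/-- Any `Q' ∈ P_{s,s'}(Q,P,R)` yields a bound on the successive-scheme exponent. -/
theorem rhoSucc_le_of_mem_PSet [Fintype 𝒳] [Fintype 𝒴] {W : 𝒮 → 𝒳 → 𝒴 → ℝ} {P : 𝒳 → ℝ}
    (hP : IsPMF P) {R : ℝ} {s s' : 𝒮} {Q Q' : 𝒳 → 𝒴 → ℝ} (hQ : IsChannel Q)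
    (hQ' : Q' ∈ PSet W Q P R s s') :
    rhoSucc W P R ≤ condKL P Q (W s) + ENNReal.ofReal (mutualInfo P Q' - R) := by
  obtain ⟨hc, hle, hout⟩ := hQ'
  rcases le_total (mutualInfo P Q) (mutualInfo P Q') with hI | hI
  · calc rhoSucc W P R ≤ condKL P Q (W s) + ENNReal.ofReal (mutualInfo P Q - R) :=
          iInf_le_of_le s (iInf₂_le Q hQ)
      _ ≤ _ := by gcongr
  · have hH : condH P Q ≤ condH P Q' := by
      rw [mutualInfo_eq_ent_sub_condH hP.1 fun x => (hc x).1,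
        mutualInfo_eq_ent_sub_condH hP.1 fun x => (hQ x).1, funext hout] at hI
      linarith
    calc rhoSucc W P R ≤ condKL P Q' (W s') + ENNReal.ofReal (mutualInfo P Q' - R) :=
          iInf_le_of_le s' (iInf₂_le Q' hc)
      _ ≤ _ := by
        gcongr
        exact condKL_le_of_add_condH_le (hle.trans (min_le_right _ _)) hH

/-- part of Corollary 8 of the paper: joint detection dominates
successive detection, `ρ_joint ≥ ρ_succ`. -/
theorem rhoJoint_ge_rhoSucc
    [Fintype 𝒳] [Fintype 𝒴] [Fintype 𝒮]
    (W : 𝒮 → 𝒳 → 𝒴 → ℝ) (hW : ∀ s, IsChannel (W s))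
    (P : 𝒳 → ℝ) (hP : IsPMF P) (R : ℝ) (hR : 0 < R) :
    rhoSucc W P R ≤ rhoJoint W P R := by
  refine le_iInf fun s => le_iInf₂ fun Q hQ => ?_
  simp only [iInf_sub_of_ne_top _ ENNReal.ofReal_ne_top, ENNReal.add_iInf,
    ← ENNReal.ofReal_sub _ hR.le]
  exact le_iInf₂ fun s' _ => le_iInf₂ fun Q' hQ' => rhoSucc_le_of_mem_PSet hP hQ hQ'

end JCAS
end

section
/- Binary Chernoff information is attained at ℓ = 1/2: For every q ∈ (0,1), the function ℓ ↦ −log( q^ℓ(1−q)^{1−ℓ} + (1−q)^ℓ q^{1−ℓ} ) on [0,1] attains its maximum at ℓ = 1/2, and the maximum value equals −log( 2√(q(1−q)) ), which equals the relative entropy D(Ber(1/2) ‖ Ber(q)) = (1/2)·log( (1/2)/q ) + (1/2)·log( (1/2)/(1−q) ). -/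
open scoped BigOperators ENNReal NNReal

namespace JCAS

variable {𝒳 𝒴 𝒵 𝒮 : Type}

/-- The binary Chernoff sum at `1 / 2` is twice the geometric mean. -/
theorem rpow_half_mul_add_eq_two_mul_sqrt {a b : ℝ} (ha : 0 ≤ a) :
    a ^ ((1 : ℝ) / 2) * b ^ (1 - (1 : ℝ) / 2) + b ^ ((1 : ℝ) / 2) * a ^ (1 - (1 : ℝ) / 2)
      = 2 * Real.sqrt (a * b) := by
  rw [show (1 : ℝ) - 1 / 2 = 1 / 2 by norm_num, Real.sqrt_mul ha,
    Real.sqrt_eq_rpow, Real.sqrt_eq_rpow]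
  ring

/-- AM-GM for the two terms of the binary Chernoff sum, whose product is `a * b`. -/
theorem two_mul_sqrt_le_rpow_mul_add {a b : ℝ} (ha : 0 < a) (hb : 0 < b) (l : ℝ) :
    2 * Real.sqrt (a * b) ≤ a ^ l * b ^ (1 - l) + b ^ l * a ^ (1 - l) := by
  have hA : a ^ l * a ^ (1 - l) = a := by
    rw [← Real.rpow_add ha, add_sub_cancel, Real.rpow_one]
  have hB : b ^ l * b ^ (1 - l) = b := by
    rw [← Real.rpow_add hb, add_sub_cancel, Real.rpow_one]
  have hprod : (a ^ l * b ^ (1 - l)) * (b ^ l * a ^ (1 - l)) = a * b := by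
    calc _ = (a ^ l * a ^ (1 - l)) * (b ^ l * b ^ (1 - l)) := by ring
      _ = a * b := by rw [hA, hB]
  refine abs_le_of_sq_le_sq' ?_ (by positivity) |>.2
  rw [mul_pow, Real.sq_sqrt (by positivity), ← hprod]
  nlinarith [sq_nonneg (a ^ l * b ^ (1 - l) - b ^ l * a ^ (1 - l))]

/-- the binary Chernoff information is attained at `ℓ = 1/2` and
equals `D(Ber(1/2) ‖ Ber(q)) = −log(2√(q(1−q)))`. -/
theorem binary_chernoff_half (q : ℝ) (hq0 : 0 < q) (hq1 : q < 1) :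
    IsMaxOn (fun ℓ : ℝ => -Real.log (q ^ ℓ * (1 - q) ^ (1 - ℓ) + (1 - q) ^ ℓ * q ^ (1 - ℓ)))
      (Set.Icc 0 1) (1 / 2) ∧
    -Real.log (q ^ ((1 : ℝ) / 2) * (1 - q) ^ (1 - (1 : ℝ) / 2)
        + (1 - q) ^ ((1 : ℝ) / 2) * q ^ (1 - (1 : ℝ) / 2))
      = -Real.log (2 * Real.sqrt (q * (1 - q))) ∧
    -Real.log (2 * Real.sqrt (q * (1 - q)))
      = (1 / 2) * Real.log ((1 / 2) / q) + (1 / 2) * Real.log ((1 / 2) / (1 - q)) := by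
  have hq : 0 < 1 - q := sub_pos.2 hq1
  refine ⟨fun l _ => ?_, ?_, ?_⟩
  · simp only [Set.mem_ofPred_eq]
    rw [rpow_half_mul_add_eq_two_mul_sqrt hq0.le]
    exact neg_le_neg (Real.log_le_log (by positivity) (two_mul_sqrt_le_rpow_mul_add hq0 hq l))
  · rw [rpow_half_mul_add_eq_two_mul_sqrt hq0.le]
  · rw [Real.log_mul two_ne_zero (by positivity), Real.log_sqrt (by positivity),
      Real.log_mul hq0.ne' hq.ne', Real.log_div (by norm_num) hq0.ne',
      Real.log_div (by norm_num) hq.ne', one_div, Real.log_inv]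
    ring

end JCAS
end
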